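/- Let F be a compact convex subset of ℝⁿ with non-empty interior, let E ⊆ F be a closed set, and let λ > 1. Define the core E_{λ,F} = {x ∈ E : for every line segment J with x ∈ J ⊆ F, the one-dimensional Lebesgue measure of E ∩ J is at least ((λ−1)/λ) times the length of J}. Then Vol(E_{λ,F})/Vol(F) ≤ (Vol(E)/Vol(F))^λ, where Vol denotes n-dimensional Lebesgue measure. -/

import Mathlib

open MeasureTheory

/-- The one-dimensional Lebesgue measure of the intersection of a set `E` with the
segment from `a` to `b`, computed via the affine parametrization of the segment. -/
noncomputable def segmentMeasure {n : ℕ} (E : Set (EuclideanSpace ℝ (Fin n)))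
    (a b : EuclideanSpace ℝ (Fin n)) : ℝ :=
  dist a b * (volume {t : ℝ | t ∈ Set.Icc (0 : ℝ) 1 ∧ a + t • (b - a) ∈ E}).toReal

/-- The core `E_{λ,F}` : the set of points `x ∈ E` such that for every segment `J`
with `x ∈ J ⊆ F`, the one-dimensional measure of `E ∩ J` is at least `((λ-1)/λ)·|J|`. -/
noncomputable def core {n : ℕ} (E F : Set (EuclideanSpace ℝ (Fin n))) (lam : ℝ) :
    Set (EuclideanSpace ℝ (Fin n)) :=
  {x | x ∈ E ∧ ∀ a b : EuclideanSpace ℝ (Fin n),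
    x ∈ segment ℝ a b → segment ℝ a b ⊆ F →
      ((lam - 1) / lam) * dist a b ≤ segmentMeasure E a b}

theorem volume_add_le_of_isCompact {K L S : Set ℝ} (hK : IsCompact K) (hL : IsCompact L)
    (hKne : K.Nonempty) (hLne : L.Nonempty) (h : ∀ x ∈ K, ∀ y ∈ L, x + y ∈ S) :
    volume K + volume L ≤ volume S := by
  obtain ⟨k, hkK, hk⟩ := hK.exists_isGreatest hKne
  obtain ⟨l, hlL, hl⟩ := hL.exists_isLeast hLne
  have hsub : (fun x => x + (-l)) ⁻¹' K ∪ (fun x => x + (-k)) ⁻¹' L ⊆ S := by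
    rintro z (hz | hz)
    · have := h _ hz l hlL
      simpa using this
    · have := h k hkK _ hz
      simpa using this
  have hm : MeasurableSet ((fun x => x + (-k)) ⁻¹' L) :=
    (measurable_add_const _) hL.measurableSet
  have hd : AEDisjoint volume ((fun x => x + (-l)) ⁻¹' K) ((fun x => x + (-k)) ⁻¹' L) := by
    refine measure_mono_null (t := {k + l}) ?_ (by simp)
    rintro z ⟨h1, h2⟩
    have h1' := hk h1
    have h2' := hl h2
    simp only [Set.mem_singleton_iff] at *
    linarith
  calc volume K + volume L
      = volume ((fun x => x + (-l)) ⁻¹' K) + volume ((fun x => x + (-k)) ⁻¹' L) := by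
        rw [measure_preimage_add_right, measure_preimage_add_right]
    _ = volume ((fun x => x + (-l)) ⁻¹' K ∪ (fun x => x + (-k)) ⁻¹' L) :=
        (measure_union₀ hm.nullMeasurableSet hd).symm
    _ ≤ volume S := measure_mono hsub

theorem volume_weighted_add_le {a b : ℝ} (ha : 0 < a) (hb : 0 < b) {A B S : Set ℝ}
    (hA : MeasurableSet A) (hB : MeasurableSet B) (hAne : A.Nonempty) (hBne : B.Nonempty)
    (h : ∀ x ∈ A, ∀ y ∈ B, a * x + b * y ∈ S) :
    ENNReal.ofReal a * volume A + ENNReal.ofReal b * volume B ≤ volume S := by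
  obtain ⟨x₀, hx₀⟩ := hAne
  obtain ⟨y₀, hy₀⟩ := hBne
  have sc : ∀ c : ℝ, 0 < c → ∀ T : Set ℝ,
      volume ((fun x => c⁻¹ * x) ⁻¹' T) = ENNReal.ofReal c * volume T := by
    intro c hc T
    rw [Real.volume_preimage_mul_left (inv_ne_zero hc.ne'), inv_inv, abs_of_pos hc]
  rw [← sc a ha, ← sc b hb]
  rw [(measurable_const_mul a⁻¹ hA).measure_eq_iSup_isCompact,
    (measurable_const_mul b⁻¹ hB).measure_eq_iSup_isCompact]
  simp only [iSup_and']
  refine ENNReal.biSup_add_biSup_le' ⟨∅, Set.empty_subset _, isCompact_empty⟩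
    ⟨∅, Set.empty_subset _, isCompact_empty⟩ ?_
  rintro K ⟨hKA, hK⟩ L ⟨hLB, hL⟩
  have h1 := volume_add_le_of_isCompact (S := S) (hK.insert (a * x₀)) (hL.insert (b * y₀))
    (Set.insert_nonempty _ _) (Set.insert_nonempty _ _) (by
      intro x hx y hy
      have hx' : a⁻¹ * x ∈ A := by
        rcases hx with rfl | hx
        · rwa [inv_mul_cancel_left₀ ha.ne']
        · exact hKA hx
      have hy' : b⁻¹ * y ∈ B := by
        rcases hy with rfl | hy
        · rwa [inv_mul_cancel_left₀ hb.ne']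
        · exact hLB hy
      have := h _ hx' _ hy'
      rwa [mul_inv_cancel_left₀ ha.ne', mul_inv_cancel_left₀ hb.ne'] at this)
  refine le_trans (add_le_add ?_ ?_) h1
  · exact measure_mono (Set.subset_insert _ _)
  · exact measure_mono (Set.subset_insert _ _)

theorem lintegral_eq_lintegral_level {f : ℝ → ENNReal} (hf : Measurable f) (hf1 : ∀ x, f x ≤ 1) :
    ∫⁻ x, f x = ∫⁻ t in Set.Ioo (0 : ℝ) 1, volume {x | ENNReal.ofReal t < f x} := by
  have hfin : ∀ x, f x ≠ ⊤ := fun x => ne_top_of_le_ne_top ENNReal.one_ne_top (hf1 x)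
  have h1 := lintegral_eq_lintegral_meas_lt (volume : Measure ℝ) (f := fun x => (f x).toReal)
    (Filter.Eventually.of_forall fun x => ENNReal.toReal_nonneg) hf.ennreal_toReal.aemeasurable
  simp only [ENNReal.ofReal_toReal (hfin _)] at h1
  rw [h1, ← lintegral_indicator measurableSet_Ioi, ← lintegral_indicator measurableSet_Ioo]
  congr 1
  ext t
  by_cases h0 : 0 < t
  · by_cases ht : t < 1
    · rw [Set.indicator_of_mem (Set.mem_Ioi.2 h0), Set.indicator_of_mem (Set.mem_Ioo.2 ⟨h0, ht⟩)]
      congr 1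
      ext x
      simp only [Set.mem_ofPred_eq]
      rw [ENNReal.ofReal_lt_iff_lt_toReal h0.le (hfin x)]
    · rw [Set.indicator_of_mem (Set.mem_Ioi.2 h0), Set.indicator_of_notMem (by simp [ht])]
      have : {x | t < (f x).toReal} = ∅ := by
        ext x
        simp only [Set.mem_ofPred_eq, Set.mem_empty_iff_false, iff_false, not_lt]
        have := ENNReal.toReal_mono ENNReal.one_ne_top (hf1 x)
        simp at this
        linarith
      simp [this]
  · simp [h0]

theorem prekopa_leindler_normalized {a b : ℝ} (ha : 0 < a) (hb : 0 < b) (hab : a + b = 1)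
    {f g h : ℝ → ENNReal} (hf : Measurable f) (hg : Measurable g) (hh : Measurable h)
    (hf1 : ⨆ x, f x = 1) (hg1 : ⨆ x, g x = 1)
    (H : ∀ x y, f x ^ a * g y ^ b ≤ h (a * x + b * y)) :
    ENNReal.ofReal a * (∫⁻ x, f x) + ENNReal.ofReal b * (∫⁻ x, g x) ≤ ∫⁻ x, h x := by
  have hfle : ∀ x, f x ≤ 1 := fun x => hf1 ▸ le_iSup f x
  have hgle : ∀ x, g x ≤ 1 := fun x => hg1 ▸ le_iSup g x
  have hmin : ∫⁻ x, min (h x) 1 ≤ ∫⁻ x, h x := lintegral_mono fun x => min_le_left _ _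
  refine le_trans ?_ hmin
  rw [lintegral_eq_lintegral_level hf hfle, lintegral_eq_lintegral_level hg hgle,
    lintegral_eq_lintegral_level (hh.min measurable_const) (fun x => min_le_right _ _)]
  have anti : ∀ k : ℝ → ENNReal, Measurable fun t : ℝ => volume {x | ENNReal.ofReal t < k x} := by
    intro k
    refine Antitone.measurable fun s t hst => measure_mono fun x hx => ?_
    exact lt_of_le_of_lt (ENNReal.ofReal_le_ofReal hst) hx
  rw [← lintegral_const_mul _ (anti f), ← lintegral_const_mul _ (anti g),
    ← lintegral_add_left ((anti f).const_mul _)]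
  refine setLIntegral_mono (anti _) fun t ht => ?_
  have ht1 : ENNReal.ofReal t < 1 := by simpa using ht.2
  refine volume_weighted_add_le ha hb (measurableSet_lt measurable_const hf)
    (measurableSet_lt measurable_const hg) ?_ ?_ ?_
  · exact lt_iSup_iff.1 (hf1 ▸ ht1)
  · exact lt_iSup_iff.1 (hg1 ▸ ht1)
  · intro x hx y hy
    simp only [Set.mem_ofPred_eq] at *
    refine lt_min (lt_of_lt_of_le ?_ (H x y)) ht1
    calc ENNReal.ofReal t = ENNReal.ofReal t ^ a * ENNReal.ofReal t ^ b := by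
          rw [← ENNReal.rpow_add_of_nonneg _ _ ha.le hb.le, hab, ENNReal.rpow_one]
      _ < f x ^ a * g y ^ b :=
          ENNReal.mul_lt_mul (ENNReal.rpow_lt_rpow hx ha) (ENNReal.rpow_lt_rpow hy hb)

theorem ENNReal.rpow_mul_rpow_le_weighted {a b : ℝ} (ha : 0 < a) (hb : 0 < b) (hab : a + b = 1)
    (x y : ENNReal) : x ^ a * y ^ b ≤ ENNReal.ofReal a * x + ENNReal.ofReal b * y := by
  have h := ENNReal.young_inequality (x ^ a) (y ^ b) (p := a⁻¹) (q := b⁻¹)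
    ⟨by simp [hab], by positivity, by positivity⟩
  rwa [← ENNReal.rpow_mul, ← ENNReal.rpow_mul, mul_inv_cancel₀ ha.ne', mul_inv_cancel₀ hb.ne',
    ENNReal.rpow_one, ENNReal.rpow_one, ENNReal.ofReal_inv_of_pos ha, ENNReal.ofReal_inv_of_pos hb,
    div_eq_mul_inv, div_eq_mul_inv, inv_inv, inv_inv, mul_comm x, mul_comm y] at h

theorem prekopa_leindler_bounded {a b : ℝ} (ha : 0 < a) (hb : 0 < b) (hab : a + b = 1)
    {f g h : ℝ → ENNReal} (hf : Measurable f) (hg : Measurable g) (hh : Measurable h)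
    (hf1 : ⨆ x, f x ≠ ⊤) (hg1 : ⨆ x, g x ≠ ⊤)
    (H : ∀ x y, f x ^ a * g y ^ b ≤ h (a * x + b * y)) :
    (∫⁻ x, f x) ^ a * (∫⁻ x, g x) ^ b ≤ ∫⁻ x, h x := by
  by_cases hf0 : ⨆ x, f x = 0
  · have : ∀ x, f x = 0 := by simpa using hf0
    simp [this, ENNReal.zero_rpow_of_pos ha]
  by_cases hg0 : ⨆ x, g x = 0
  · have : ∀ x, g x = 0 := by simpa using hg0
    simp [this, ENNReal.zero_rpow_of_pos hb]
  set s := ⨆ x, f x with hs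
  set r := ⨆ x, g x with hr
  have hc0 : s ^ a * r ^ b ≠ 0 := mul_ne_zero
    (by simp [ENNReal.rpow_eq_zero_iff, hf0, hf1]) (by simp [ENNReal.rpow_eq_zero_iff, hg0, hg1])
  have hct : s ^ a * r ^ b ≠ ⊤ := ENNReal.mul_ne_top
    (ENNReal.rpow_ne_top_of_nonneg ha.le hf1) (ENNReal.rpow_ne_top_of_nonneg hb.le hg1)
  have main := prekopa_leindler_normalized ha hb hab (f := fun x => s⁻¹ * f x)
    (g := fun x => r⁻¹ * g x) (h := fun x => (s ^ a * r ^ b)⁻¹ * h x)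
    (hf.const_mul _) (hg.const_mul _) (hh.const_mul _)
    (by rw [← ENNReal.mul_iSup, ← hs, ENNReal.inv_mul_cancel hf0 hf1])
    (by rw [← ENNReal.mul_iSup, ← hr, ENNReal.inv_mul_cancel hg0 hg1])
    (fun x y => by
      rw [ENNReal.mul_rpow_of_nonneg _ _ ha.le, ENNReal.mul_rpow_of_nonneg _ _ hb.le,
        ENNReal.inv_rpow, ENNReal.inv_rpow]
      calc _ = ((s ^ a)⁻¹ * (r ^ b)⁻¹) * (f x ^ a * g y ^ b) := by ring
        _ ≤ _ := by
          rw [ENNReal.mul_inv]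
          · gcongr
            exact H x y
          · right; exact ENNReal.rpow_ne_top_of_nonneg hb.le hg1
          · left; exact ENNReal.rpow_ne_top_of_nonneg ha.le hf1)
  have main2 := (ENNReal.rpow_mul_rpow_le_weighted ha hb hab _ _).trans main
  rw [lintegral_const_mul _ hf, lintegral_const_mul _ hg, lintegral_const_mul _ hh,
    ENNReal.mul_rpow_of_nonneg _ _ ha.le, ENNReal.mul_rpow_of_nonneg _ _ hb.le,
        ENNReal.inv_rpow, ENNReal.inv_rpow] at main2
  have e : (s ^ a)⁻¹ * (∫⁻ x, f x) ^ a * ((r ^ b)⁻¹ * (∫⁻ x, g x) ^ b)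
      = (s ^ a * r ^ b)⁻¹ * ((∫⁻ x, f x) ^ a * (∫⁻ x, g x) ^ b) := by
    rw [ENNReal.mul_inv]
    · ring
    · right; exact ENNReal.rpow_ne_top_of_nonneg hb.le hg1
    · left; exact ENNReal.rpow_ne_top_of_nonneg ha.le hf1
  rw [e] at main2
  exact (ENNReal.mul_le_mul_iff_right (ENNReal.inv_ne_zero.2 hct) (ENNReal.inv_ne_top.2 hc0)).1 main2

theorem prekopa_leindler_real {a b : ℝ} (ha : 0 < a) (hb : 0 < b) (hab : a + b = 1)
    {f g h : ℝ → ENNReal} (hf : Measurable f) (hg : Measurable g) (hh : Measurable h)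
    (H : ∀ x y, f x ^ a * g y ^ b ≤ h (a * x + b * y)) :
    (∫⁻ x, f x) ^ a * (∫⁻ x, g x) ^ b ≤ ∫⁻ x, h x := by
  have trunc : ∀ k : ℝ → ENNReal, Measurable k → Filter.Tendsto
      (fun N : ℕ => ∫⁻ x, min (k x) N) Filter.atTop (nhds (∫⁻ x, k x)) := by
    intro k hk
    refine lintegral_tendsto_of_tendsto_of_monotone
      (fun N => (hk.min measurable_const).aemeasurable) ?_ ?_
    · refine Filter.Eventually.of_forall fun x N M hNM => ?_
      exact min_le_min le_rfl (by exact_mod_cast hNM)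
    · refine Filter.Eventually.of_forall fun x => ?_
      have := (tendsto_const_nhds (x := k x)).min ENNReal.tendsto_nat_nhds_top
      simpa using this
  by_cases hf0 : ∫⁻ x, f x = 0
  · simp [hf0, ENNReal.zero_rpow_of_pos ha]
  by_cases hg0 : ∫⁻ x, g x = 0
  · simp [hg0, ENNReal.zero_rpow_of_pos hb]
  have lim := ENNReal.Tendsto.mul
    (((ENNReal.continuous_rpow_const (y := a)).tendsto _).comp (trunc f hf))
    (Or.inl (by simp [ENNReal.rpow_eq_zero_iff, hf0, ha.not_gt]))
    (((ENNReal.continuous_rpow_const (y := b)).tendsto _).comp (trunc g hg))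
    (Or.inl (by simp [ENNReal.rpow_eq_zero_iff, hg0, hb.not_gt]))
  refine le_of_tendsto' lim fun N => ?_
  have bd : ∀ k : ℝ → ENNReal, ⨆ x, min (k x) (N : ENNReal) ≠ ⊤ := fun k =>
    ne_top_of_le_ne_top (ENNReal.natCast_ne_top N) (iSup_le fun x => min_le_right _ _)
  refine prekopa_leindler_bounded ha hb hab (hf.min measurable_const) (hg.min measurable_const) hh
    (bd f) (bd g) fun x y => le_trans ?_ (H x y)
  gcongr <;> exact min_le_left _ _

theorem lintegral_fin_succ_insertNth {n : ℕ} (i : Fin (n + 1)) {f : (Fin (n + 1) → ℝ) → ENNReal}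
    (hf : Measurable f) :
    ∫⁻ x, f x = ∫⁻ s : ℝ, ∫⁻ y : Fin n → ℝ, f (i.insertNth s y) := by
  have h := (volume_preserving_piFinSuccAbove (fun _ : Fin (n + 1) => ℝ) i).symm
  rw [← h.lintegral_comp hf, Measure.volume_eq_prod, lintegral_prod]
  · rfl
  · exact (hf.comp (MeasurableEquiv.measurable _)).aemeasurable

theorem measurable_insertNth {n : ℕ} (i : Fin (n + 1)) :
    Measurable fun p : ℝ × (Fin n → ℝ) => (i.insertNth p.1 p.2 : Fin (n + 1) → ℝ) :=
  (MeasurableEquiv.piFinSuccAbove (fun _ : Fin (n + 1) => ℝ) i).symm.measurable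

theorem prekopa_leindler {a b : ℝ} (ha : 0 < a) (hb : 0 < b) (hab : a + b = 1) {n : ℕ}
    {f g h : (Fin n → ℝ) → ENNReal} (hf : Measurable f) (hg : Measurable g) (hh : Measurable h)
    (H : ∀ x y, f x ^ a * g y ^ b ≤ h (a • x + b • y)) :
    (∫⁻ x, f x) ^ a * (∫⁻ x, g x) ^ b ≤ ∫⁻ x, h x := by
  induction n with
  | zero =>
    simp only [lintegral_unique]
    have hv : (volume : Measure (Fin 0 → ℝ)) Set.univ = 1 := by simp [volume_pi]
    rw [hv, mul_one, mul_one, mul_one]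
    have := H default default
    rw [Subsingleton.elim (a • (default : Fin 0 → ℝ) + b • default) default] at this
    convert this
  | succ n ih =>
    rw [lintegral_fin_succ_insertNth 0 hf, lintegral_fin_succ_insertNth 0 hg,
      lintegral_fin_succ_insertNth 0 hh]
    have m : ∀ k : (Fin (n + 1) → ℝ) → ENNReal, Measurable k →
        Measurable fun s : ℝ => ∫⁻ y : Fin n → ℝ, k ((0 : Fin (n + 1)).insertNth s y) :=
      fun k hk => (hk.comp (measurable_insertNth 0)).lintegral_prod_right'
    have m2 : ∀ k : (Fin (n + 1) → ℝ) → ENNReal, Measurable k → ∀ s : ℝ,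
        Measurable fun y : Fin n → ℝ => k ((0 : Fin (n + 1)).insertNth s y) :=
      fun k hk s => hk.comp ((measurable_insertNth 0).comp measurable_prodMk_left)
    refine prekopa_leindler_real ha hb hab (m f hf) (m g hg) (m h hh) fun s t => ?_
    refine ih (m2 f hf s) (m2 g hg t) (m2 h hh _) fun x y => ?_
    convert H (Fin.insertNth 0 s x) (Fin.insertNth 0 t y) using 2
    ext j
    refine Fin.cases ?_ (fun j => ?_) j <;> simp

theorem volume_inter_le_of_gaps {A B : Set ℝ} {w v δ : ℝ} (hA : IsClosed A)
    (hAB : Disjoint A B) (hv : v ∈ A) (hδ : 0 ≤ δ)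
    (hc : ∀ x ∈ A, w ≤ x → x ≤ v → ∀ t, w ≤ t → t ≤ x →
      volume (B ∩ Set.Icc t x) ≤ ENNReal.ofReal (δ * (x - t))) :
    volume (B ∩ Set.Icc w v) ≤ ENNReal.ofReal δ * volume (Set.Icc w v \ A) := by
  set n : ℝ → ℝ := fun x => sInf (A ∩ Set.Icc x v) with hn
  set O : Set ℝ := Set.Icc w v \ A with hO
  have hbdd : ∀ x, BddBelow (A ∩ Set.Icc x v) := fun x => ⟨x, fun y hy => hy.2.1⟩
  have hmem : ∀ x ≤ v, n x ∈ A ∩ Set.Icc x v := fun x hx =>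
    (hA.inter isClosed_Icc).csInf_mem ⟨v, hv, hx, le_rfl⟩ (hbdd x)
  have hlt : ∀ x ∈ O, x < n x := fun x hx =>
    lt_of_le_of_ne (hmem x hx.1.2).2.1 fun h => hx.2 (h ▸ (hmem x hx.1.2).1)
  have hgap : ∀ x y, x ≤ y → y < n x → y ≤ v → y ∉ A := fun x y hxy hy hyv hyA =>
    absurd (csInf_le (hbdd x) ⟨hyA, hxy, hyv⟩) (not_le.2 hy)
  have hconst : ∀ x ∈ O, ∀ y, x ≤ y → y < n x → y ∈ O ∧ n y = n x := by
    intro x hx y hxy hy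
    have hyv : y ≤ v := hy.le.trans (hmem x hx.1.2).2.2
    refine ⟨⟨⟨hx.1.1.trans hxy, hyv⟩, hgap x y hxy hy hyv⟩, le_antisymm ?_ ?_⟩
    · exact csInf_le (hbdd y) ⟨(hmem x hx.1.2).1, hy.le, (hmem x hx.1.2).2.2⟩
    · exact csInf_le (hbdd x) ⟨(hmem y hyv).1, hxy.trans (hmem y hyv).2.1, (hmem y hyv).2.2⟩
  set S : ℝ → Set ℝ := fun c => {x | x ∈ O ∧ n x = c} with hS
  have hcount : (n '' O).Countable := by
    refine (Set.countable_range fun q : ℚ => n q).mono ?_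
    rintro _ ⟨x, hx, rfl⟩
    obtain ⟨q, hq1, hq2⟩ := exists_rat_btwn (hlt x hx)
    exact ⟨q, (hconst x hx q hq1.le hq2).2⟩
  have hSm : ∀ c, MeasurableSet (S c) := by
    intro c
    refine Set.OrdConnected.measurableSet ⟨?_⟩
    rintro x ⟨hx, rfl⟩ z ⟨hz, hzx⟩ y ⟨hxy, hyz⟩
    exact hconst x hx y hxy (hyz.trans_lt (hzx ▸ hlt z hz))
  have hone : ∀ c ∈ n '' O, volume (B ∩ S c) ≤ ENNReal.ofReal δ * volume (S c) := by
    rintro _ ⟨x, hx, rfl⟩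
    set c := n x with hcdef
    have hne : (S c).Nonempty := ⟨x, hx, rfl⟩
    have hSb : BddBelow (S c) := ⟨w, fun y hy => hy.1.1.1⟩
    set x₀ := sInf (S c) with hx₀
    have hwx₀ : w ≤ x₀ := le_csInf hne fun y hy => hy.1.1.1
    have hx₀c : x₀ ≤ c := (csInf_le hSb ⟨hx, rfl⟩).trans (hlt x hx).le
    have h1 : B ∩ S c ⊆ B ∩ Set.Icc x₀ c := fun y hy =>
      ⟨hy.1, csInf_le hSb hy.2, hy.2.2 ▸ (hlt y hy.2.1).le⟩
    have h2 : Set.Ioo x₀ c ⊆ S c := by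
      intro y hy
      obtain ⟨z, hz, hzy⟩ := exists_lt_of_csInf_lt hne hy.1
      have := hconst z hz.1 y hzy.le (hz.2.symm ▸ hy.2)
      exact ⟨this.1, this.2.trans hz.2⟩
    have hcA := hmem x hx.1.2
    calc volume (B ∩ S c) ≤ volume (B ∩ Set.Icc x₀ c) := measure_mono h1
      _ ≤ ENNReal.ofReal (δ * (c - x₀)) :=
          hc c hcA.1 (hwx₀.trans hx₀c) hcA.2.2 x₀ hwx₀ hx₀c
      _ = ENNReal.ofReal δ * volume (Set.Ioo x₀ c) := by
          rw [Real.volume_Ioo, ENNReal.ofReal_mul hδ]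
      _ ≤ ENNReal.ofReal δ * volume (S c) := by gcongr
  have hcov : B ∩ Set.Icc w v ⊆ ⋃ c ∈ n '' O, B ∩ S c := by
    intro x hx
    have hxO : x ∈ O := ⟨hx.2, fun hxA => Set.disjoint_left.1 hAB hxA hx.1⟩
    exact Set.mem_biUnion (Set.mem_image_of_mem n hxO) ⟨hx.1, hxO, rfl⟩
  have hdisj : (n '' O).PairwiseDisjoint S := by
    intro c _ d _ hcd
    refine Set.disjoint_left.2 fun x hx hx' => hcd (hx.2.symm.trans hx'.2)
  calc volume (B ∩ Set.Icc w v) ≤ volume (⋃ c ∈ n '' O, B ∩ S c) := measure_mono hcov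
    _ ≤ ∑' c : n '' O, volume (B ∩ S c) := measure_biUnion_le _ hcount _
    _ ≤ ∑' c : n '' O, ENNReal.ofReal δ * volume (S c) :=
        ENNReal.tsum_le_tsum fun c => hone c c.2
    _ = ENNReal.ofReal δ * volume (⋃ c ∈ n '' O, S c) := by
        rw [ENNReal.tsum_mul_left, measure_biUnion hcount hdisj fun c _ => hSm c]
    _ ≤ ENNReal.ofReal δ * volume O := by
        gcongr
        exact Set.iUnion₂_subset fun c _ x hx => hx.1

theorem lintegral_Ico_mono_measure_of_monotoneOn {μ ν : Measure ℝ} [NullSingletonClass ν] {φ : ℝ → ℝ}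
    {w v : ℝ} (hφ : MonotoneOn φ (Set.Ico w v)) (hφ0 : ∀ x ∈ Set.Ico w v, 0 ≤ φ x)
    (h : ∀ t ∈ Set.Icc w v, μ (Set.Ico t v) ≤ ν (Set.Ico t v)) :
    ∫⁻ x in Set.Ico w v, ENNReal.ofReal (φ x) ∂μ ≤
      ∫⁻ x in Set.Ico w v, ENNReal.ofReal (φ x) ∂ν := by
  have h0 : ∀ κ : Measure ℝ, 0 ≤ᵐ[κ.restrict (Set.Ico w v)] φ := fun κ =>
    (ae_restrict_iff' measurableSet_Ico).2 (Filter.Eventually.of_forall hφ0)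
  have hm : ∀ κ : Measure ℝ, AEMeasurable φ (κ.restrict (Set.Ico w v)) := fun κ =>
    aemeasurable_restrict_of_monotoneOn measurableSet_Ico hφ
  rw [lintegral_eq_lintegral_meas_lt _ (h0 μ) (hm μ), lintegral_eq_lintegral_meas_lt _ (h0 ν) (hm ν)]
  refine lintegral_mono fun a => ?_
  simp only [Measure.restrict_apply' measurableSet_Ico]
  set U := {x | a < φ x} ∩ Set.Ico w v with hU
  rcases U.eq_empty_or_nonempty with hE | hne
  · simp [hE]
  have hb : BddBelow U := ⟨w, fun x hx => hx.2.1⟩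
  obtain ⟨x₁, hx₁⟩ := id hne
  have hs : sInf U ∈ Set.Icc w v :=
    ⟨le_csInf hne fun x hx => hx.2.1, (csInf_le hb hx₁).trans hx₁.2.2.le⟩
  have h1 : U ⊆ Set.Ico (sInf U) v := fun x hx => ⟨csInf_le hb hx, hx.2.2⟩
  have h2 : Set.Ioo (sInf U) v ⊆ U := by
    intro x hx
    obtain ⟨y, hy, hyx⟩ := exists_lt_of_csInf_lt hne hx.1
    have hxI : x ∈ Set.Ico w v := ⟨hy.2.1.trans hyx.le, hx.2⟩
    exact ⟨lt_of_lt_of_le hy.1 (hφ hy.2 hxI hyx.le), hxI⟩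
  calc μ U ≤ μ (Set.Ico (sInf U) v) := measure_mono h1
    _ ≤ ν (Set.Ico (sInf U) v) := h _ hs
    _ = ν (Set.Ioo (sInf U) v) := (measure_congr Ioo_ae_eq_Ico).symm
    _ ≤ ν U := measure_mono h2

/-- If `B` occupies at most a `δ`-fraction of every interval ending at a point of `A`, it carries at
most a `δ`-fraction of the mass outside `A` of any density increasing towards `v ∈ A`. -/
theorem setIntegral_inter_Ico_le_of_monotoneOn {A B : Set ℝ} {w v δ : ℝ} {φ : ℝ → ℝ}
    (hA : IsClosed A) (hB : MeasurableSet B)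
    (hAB : Disjoint A B) (hv : v ∈ A) (hδ : 0 ≤ δ)
    (hc : ∀ x ∈ A, w ≤ x → x ≤ v → ∀ t, w ≤ t → t ≤ x →
      volume (B ∩ Set.Icc t x) ≤ ENNReal.ofReal (δ * (x - t)))
    (hφ : MonotoneOn φ (Set.Ico w v)) (hφ0 : ∀ x ∈ Set.Ico w v, 0 ≤ φ x)
    (hφi : IntegrableOn φ (Set.Ico w v)) :
    ∫ x in Set.Ico w v ∩ B, φ x ≤ δ * ∫ x in Set.Ico w v \ A, φ x := by
  have : NullSingletonClass (ENNReal.ofReal δ • volume.restrict Aᶜ) :=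
    ⟨fun x => by simp⟩
  have key := lintegral_Ico_mono_measure_of_monotoneOn (μ := volume.restrict B)
    (ν := ENNReal.ofReal δ • volume.restrict Aᶜ) hφ hφ0 (by
      intro t ht
      have h := volume_inter_le_of_gaps (w := t) hA hAB hv hδ
        fun x hx h1 h2 s h3 h4 => hc x hx (ht.1.trans h1) h2 s (ht.1.trans h3) h4
      rw [Measure.smul_apply, Measure.restrict_apply measurableSet_Ico,
        Measure.restrict_apply measurableSet_Ico, smul_eq_mul]
      calc volume (Set.Ico t v ∩ B) ≤ volume (B ∩ Set.Icc t v) :=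
            measure_mono fun x hx => ⟨hx.2, hx.1.1, hx.1.2.le⟩
        _ ≤ _ := h
        _ = _ := by
          congr 1
          refine measure_congr ?_
          exact (Ico_ae_eq_Icc (μ := volume)).symm.inter (ae_eq_refl _))
  rw [Measure.restrict_smul, lintegral_smul_measure, Measure.restrict_restrict measurableSet_Ico,
    Measure.restrict_restrict measurableSet_Ico, ← Set.sdiff_eq_compl_inter.trans (Set.inter_comm _ _)] at key
  have nn : ∀ T ⊆ Set.Ico w v, MeasurableSet T → 0 ≤ᵐ[volume.restrict T] φ := fun T hT hm =>
    (ae_restrict_iff' hm).2 (Filter.Eventually.of_forall fun x hx => hφ0 x (hT hx))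
  have m1 := measurableSet_Ico (a := w) (b := v) |>.inter hB
  have m2 := measurableSet_Ico (a := w) (b := v) |>.diff hA.measurableSet
  have e1 := ofReal_integral_eq_lintegral_ofReal (hφi.mono_set Set.inter_subset_left)
    (nn _ Set.inter_subset_left m1)
  have e2 := ofReal_integral_eq_lintegral_ofReal (hφi.mono_set Set.sdiff_subset)
    (nn _ Set.sdiff_subset m2)
  rw [← e1, ← e2, smul_eq_mul, ← ENNReal.ofReal_mul hδ] at key
  exact (ENNReal.ofReal_le_ofReal_iff (mul_nonneg hδ (integral_nonneg_of_ae (nn _ Set.sdiff_subset m2)))).1 key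

theorem abs_log_sub_log_le {R x y : ℝ} (hR : 0 < R) (hx : R ≤ x) (hy : R ≤ y) :
    |Real.log x - Real.log y| ≤ R⁻¹ * |x - y| := by
  wlog h : y ≤ x generalizing x y
  · rw [abs_sub_comm, abs_sub_comm x]
    exact this hy hx (le_of_not_ge h)
  have hy0 : 0 < y := hR.trans_le hy
  have hx0 : 0 < x := hR.trans_le hx
  rw [abs_of_nonneg (sub_nonneg.2 (Real.log_le_log hy0 h)), abs_of_nonneg (sub_nonneg.2 h),
    ← Real.log_div hx0.ne' hy0.ne']
  calc Real.log (x / y) ≤ x / y - 1 := Real.log_le_sub_one_of_pos (by positivity)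
    _ = y⁻¹ * (x - y) := by field_simp
    _ ≤ R⁻¹ * (x - y) := by
      have := sub_nonneg.2 h
      gcongr

theorem AbsolutelyContinuousOnInterval.log {K : ℝ → ℝ} {w v R : ℝ} (hR : 0 < R)
    (hK : AbsolutelyContinuousOnInterval K w v) (hKR : ∀ x ∈ Set.uIcc w v, R ≤ K x) :
    AbsolutelyContinuousOnInterval (fun x => Real.log (K x)) w v := by
  rw [absolutelyContinuousOnInterval_iff] at hK ⊢
  intro ε hε
  obtain ⟨η, hη, h⟩ := hK (R * ε) (by positivity)
  refine ⟨η, hη, fun E hE hlt => ?_⟩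
  calc ∑ i ∈ Finset.range E.1, dist (Real.log (K (E.2 i).1)) (Real.log (K (E.2 i).2))
      ≤ ∑ i ∈ Finset.range E.1, R⁻¹ * dist (K (E.2 i).1) (K (E.2 i).2) := by
        refine Finset.sum_le_sum fun i hi => ?_
        have hi' := hE.1 i hi
        exact abs_log_sub_log_le hR (hKR _ hi'.1) (hKR _ hi'.2)
    _ = R⁻¹ * ∑ i ∈ Finset.range E.1, dist (K (E.2 i).1) (K (E.2 i).2) := by rw [Finset.mul_sum]
    _ < R⁻¹ * (R * ε) := by
        gcongr
        exact h E hE hlt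
    _ = ε := by field_simp

theorem integral_div_tail_eq_log {g : ℝ → ℝ} {w v R : ℝ} (hg : Integrable g)
    (hg0 : ∀ x, 0 ≤ g x) (hR : 0 < R) (hwv : w ≤ v) :
    ∫ y in w..v, g y / (R + ∫ x in y..v, g x) =
      Real.log (R + ∫ x in w..v, g x) - Real.log R := by
  set K : ℝ → ℝ := fun y => R + ∫ x in y..v, g x with hK
  have hKR : ∀ y ≤ v, R ≤ K y := fun y hy =>
    le_add_of_nonneg_right (intervalIntegral.integral_nonneg hy fun x _ => hg0 x)
  have hKeq : K = fun y => R - ∫ x in v..y, g x := by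
    funext y
    simp only [hK]
    rw [intervalIntegral.integral_symm]
    ring
  have hKac : AbsolutelyContinuousOnInterval K w v := by
    have h1 := (hg.intervalIntegrable (a := w) (b := v)).absolutelyContinuousOnInterval_intervalIntegral
      (c := v) Set.right_mem_uIcc
    have h2 : AbsolutelyContinuousOnInterval (fun _ : ℝ => R) w v :=
      (LipschitzWith.const R).lipschitzOnWith.absolutelyContinuousOnInterval
    rw [hKeq]
    exact h2.sub h1
  have hlog := hKac.log hR (fun x hx => hKR x (by rw [Set.uIcc_of_le hwv] at hx; exact hx.2))
  have hftc := hlog.integral_deriv_eq_sub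
  have hder : ∀ᵐ y, y ∈ Set.uIoc w v → deriv (fun x => Real.log (K x)) y = -(g y / K y) := by
    filter_upwards [LocallyIntegrable.ae_hasDerivAt_integral hg.locallyIntegrable] with y hy hyI
    rw [Set.uIoc_of_le hwv] at hyI
    have hKy : HasDerivAt K (-(g y)) y := by
      rw [hKeq]
      exact (hy v).const_sub R
    have := (hKy.log (hR.trans_le (hKR y hyI.2)).ne').deriv
    rw [this, neg_div]
  rw [intervalIntegral.integral_congr_ae hder, intervalIntegral.integral_neg] at hftc
  have e1 : K v = R := by simp [hK]
  rw [e1] at hftc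
  change ∫ y in w..v, g y / K y = Real.log (K w) - Real.log R
  linarith

theorem mul_integral_tail_le {f : ℝ → ℝ} (hf : Integrable f) (hf0 : ∀ x, 0 ≤ f x)
    (hLC : ∀ s t y, s ≤ t → t ≤ y → f s * f y ≤ f t * f (s + y - t)) {s t r : ℝ}
    (hst : s ≤ t) (htr : t ≤ r) :
    f s * ∫ y in t..r, f y ≤ f t * ∫ y in s..r, f y := by
  have h1 : ∫ y in t..r, f (s + y - t) = ∫ y in s..(r - (t - s)), f y := by
    have := intervalIntegral.integral_comp_sub_right (a := t) (b := r) f (t - s)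
    rw [show t - (t - s) = s by ring] at this
    rw [← this]
    congr 1
    ext y
    congr 1
    ring
  have h2 : ∫ y in s..(r - (t - s)), f y ≤ ∫ y in s..r, f y :=
    intervalIntegral.integral_mono_interval le_rfl (by linarith) (by linarith)
      (Filter.Eventually.of_forall hf0) hf.intervalIntegrable
  calc f s * ∫ y in t..r, f y = ∫ y in t..r, f s * f y :=
        (intervalIntegral.integral_const_mul _ _).symm
    _ ≤ ∫ y in t..r, f t * f (s + y - t) := by
        refine intervalIntegral.integral_mono_on htr (hf.const_mul _).intervalIntegrable ?_ ?_
        · have : Integrable fun y => f (s + y - t) := by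
            have e : (fun y => f (s + y - t)) = fun y => f (y - (t - s)) := by
              funext y
              congr 1
              ring
            rw [e]
            exact hf.comp_sub_right (t - s)
          exact (this.const_mul _).intervalIntegrable
        · exact fun y hy => hLC s t y hst hy.1
    _ = f t * ∫ y in t..r, f (s + y - t) := intervalIntegral.integral_const_mul _ _
    _ ≤ f t * ∫ y in s..r, f y := by
        rw [h1]
        exact mul_le_mul_of_nonneg_left h2 (hf0 t)

/-- A log-concave density loses at most a power of its tail when a set `B` occupying at most a
`δ`-fraction of every `[t, v]` is removed from `[w, v]`. -/
theorem rpow_tail_le_of_density {f : ℝ → ℝ} (hf : Integrable f)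
    (hf0 : ∀ x, 0 ≤ f x)
    (hLC : ∀ s t y, s ≤ t → t ≤ y → f s * f y ≤ f t * f (s + y - t)) {B : Set ℝ}
    (hB : MeasurableSet B) {w v r δ : ℝ} (hwv : w ≤ v) (hvr : v ≤ r) (hδ : 0 < δ)
    (hc : ∀ t, w ≤ t → t ≤ v → volume (B ∩ Set.Icc t v) ≤ ENNReal.ofReal (δ * (v - t))) :
    (∫ x in v..r, f x) ^ δ * (∫ x in w..r, f x) ^ (1 - δ) ≤
      (∫ x in v..r, f x) + ∫ x in w..v, Bᶜ.indicator f x := by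
  set R := ∫ x in v..r, f x with hRdef
  set g := Bᶜ.indicator f with hg
  have hgf : ∀ x, g x ≤ f x := fun x => Set.indicator_le_self' (fun _ _ => hf0 _) x
  have hg0 : ∀ x, 0 ≤ g x := fun x => Set.indicator_nonneg (fun _ _ => hf0 _) x
  have hgi : Integrable g := hf.indicator hB.compl
  have hR0 : 0 ≤ R := intervalIntegral.integral_nonneg hvr fun x _ => hf0 x
  have hX0 : 0 ≤ ∫ x in w..v, g x := intervalIntegral.integral_nonneg hwv fun x _ => hg0 x
  rcases hR0.eq_or_lt with hR | hR
  · rw [← hR, Real.zero_rpow hδ.ne', zero_mul, zero_add]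
    exact hX0
  set M : ℝ → ℝ := fun y => R + ∫ x in y..v, f x with hM
  have hadd : ∀ y, M y = ∫ x in y..r, f x := fun y => by
    simp only [hM, hRdef]
    rw [add_comm]
    exact intervalIntegral.integral_add_adjacent_intervals hf.intervalIntegrable hf.intervalIntegrable
  have hMR : ∀ y ≤ v, R ≤ M y := fun y hy =>
    le_add_of_nonneg_right (intervalIntegral.integral_nonneg hy fun x _ => hf0 x)
  have hMpos : ∀ y ≤ v, 0 < M y := fun y hy => hR.trans_le (hMR y hy)
  have hcont : ∀ k : ℝ → ℝ, Integrable k → Continuous fun y => R + ∫ x in y..v, k x := by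
    intro k hk
    have : Continuous fun y => ∫ x in v..y, k x :=
      intervalIntegral.continuous_primitive (fun a b => hk.intervalIntegrable) v
    simp_rw [fun y => intervalIntegral.integral_symm (f := k) (μ := volume) v y]
    exact continuous_const.add this.neg
  have hbd : ∀ k m : ℝ → ℝ, Integrable k → (∀ x, 0 ≤ k x) → Continuous m → (∀ y ≤ v, R ≤ m y) →
      IntegrableOn (fun y => k y / m y) (Set.Icc w v) := by
    intro k m hk hk0 hm hmR
    refine Integrable.mono' (g := fun y => k y * R⁻¹) (hk.mul_const _).integrableOn ?_ ?_
    · exact (hk.aestronglyMeasurable.aemeasurable.div hm.measurable.aemeasurable).aestronglyMeasurable.restrict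
    · refine (ae_restrict_iff' measurableSet_Icc).2 (Filter.Eventually.of_forall fun y hy => ?_)
      have h1 := hmR y hy.2
      have h2 := hk0 y
      rw [Real.norm_of_nonneg (div_nonneg h2 (hR.le.trans h1)), div_eq_mul_inv]
      gcongr
  set φ : ℝ → ℝ := fun y => f y / M y with hφ
  have hφi : IntegrableOn φ (Set.Icc w v) := hbd f M hf hf0 (hcont f hf) hMR
  have hφmono : MonotoneOn φ (Set.Ico w v) := by
    intro s hs t ht hst
    simp only [hφ]
    rw [div_le_div_iff₀ (hMpos s hs.2.le) (hMpos t ht.2.le), hadd, hadd]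
    exact mul_integral_tail_le hf hf0 hLC hst (ht.2.le.trans hvr)
  have hφ0 : ∀ x ∈ Set.Ico w v, 0 ≤ φ x := fun x hx => div_nonneg (hf0 x) (hMpos x hx.2.le).le
  have hBfrac : ∫ x in Set.Ico w v ∩ (B \ {v}), φ x ≤ δ * ∫ x in Set.Ico w v \ {v}, φ x := by
    refine setIntegral_inter_Ico_le_of_monotoneOn isClosed_singleton
      (hB.diff (measurableSet_singleton v)) Set.disjoint_sdiff_right rfl hδ.le ?_ hφmono hφ0
      (hφi.mono_set Set.Ico_subset_Icc_self)
    rintro x rfl _ _ t ht1 ht2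
    exact (measure_mono (Set.inter_subset_inter_left _ Set.sdiff_subset)).trans (hc t ht1 ht2)
  have e1 : Set.Ico w v ∩ (B \ {v}) = Set.Ico w v ∩ B := by
    ext x
    simp only [Set.mem_inter_iff, Set.mem_sdiff, Set.mem_Ico, Set.mem_singleton_iff]
    constructor
    · tauto
    · rintro ⟨⟨h1, h2⟩, h3⟩
      exact ⟨⟨h1, h2⟩, h3, h2.ne⟩
  have e2 : Set.Ico w v \ {v} = Set.Ico w v := by simp
  rw [e1, e2] at hBfrac
  have hlogM := integral_div_tail_eq_log hf hf0 hR hwv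
  have hlogK := integral_div_tail_eq_log hgi hg0 hR hwv
  have hcomp : ∫ y in w..v, g y / M y ≤ ∫ y in w..v, g y / (R + ∫ x in y..v, g x) := by
    refine intervalIntegral.integral_mono_on hwv ?_ ?_ fun y hy => ?_
    · rw [intervalIntegrable_iff_integrableOn_Icc_of_le hwv]
      exact hbd g M hgi hg0 (hcont f hf) hMR
    · rw [intervalIntegrable_iff_integrableOn_Icc_of_le hwv]
      exact hbd g _ hgi hg0 (hcont g hgi) fun y hy =>
        le_add_of_nonneg_right (intervalIntegral.integral_nonneg hy fun x _ => hg0 x)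
    · have h1 : 0 ≤ ∫ x in y..v, g x := intervalIntegral.integral_nonneg hy.2 fun x _ => hg0 x
      have h2 : ∫ x in y..v, g x ≤ ∫ x in y..v, f x :=
        intervalIntegral.integral_mono_on hy.2 hgi.intervalIntegrable hf.intervalIntegrable
          fun x _ => hgf x
      refine div_le_div_of_nonneg_left (hg0 y) (by linarith) ?_
      simp only [hM]
      linarith
  have hsplit : ∫ y in w..v, g y / M y = (∫ y in w..v, φ y) - ∫ x in Set.Ico w v ∩ B, φ x := by
    have h1 : (fun y => g y / M y) = Bᶜ.indicator φ := by
      ext y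
      by_cases hy : y ∈ B <;> simp [hg, hφ, hy]
    rw [h1, intervalIntegral.integral_of_le hwv, intervalIntegral.integral_of_le hwv,
      ← integral_Ico_eq_integral_Ioc, ← integral_Ico_eq_integral_Ioc,
      setIntegral_indicator hB.compl]
    have := integral_inter_add_sdiff hB (hφi.mono_set Set.Ico_subset_Icc_self)
    rw [Set.sdiff_eq] at this
    linarith
  have hIco : ∫ y in w..v, φ y = ∫ y in Set.Ico w v, φ y := by
    rw [intervalIntegral.integral_of_le hwv, ← integral_Ico_eq_integral_Ioc]
  rw [← hIco] at hBfrac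
  have hfinal : (1 - δ) * (Real.log (M w) - Real.log R) ≤
      Real.log (R + ∫ x in w..v, g x) - Real.log R := by
    rw [← hlogK]
    refine le_trans ?_ hcomp
    rw [hsplit, ← hlogM]
    change (1 - δ) * ∫ y in w..v, φ y ≤ _
    linarith
  rw [← hadd w]
  have hRX : 0 < R + ∫ x in w..v, g x := by linarith
  rw [← Real.log_le_log_iff (mul_pos (Real.rpow_pos_of_pos hR _)
    (Real.rpow_pos_of_pos (hMpos w hwv) _)) hRX, Real.log_mul (Real.rpow_pos_of_pos hR _).ne'
    (Real.rpow_pos_of_pos (hMpos w hwv) _).ne', Real.log_rpow hR, Real.log_rpow (hMpos w hwv)]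
  linarith

theorem volume_preimage_neg_inter_Icc (B : Set ℝ) (a b : ℝ) :
    volume ((fun x => -x) ⁻¹' B ∩ Set.Icc a b) = volume (B ∩ Set.Icc (-b) (-a)) := by
  have : (fun x : ℝ => -x) ⁻¹' B ∩ Set.Icc a b = (fun x => -x) ⁻¹' (B ∩ Set.Icc (-b) (-a)) := by
    ext x
    simp only [Set.mem_inter_iff, Set.mem_preimage, Set.mem_Icc, neg_le_neg_iff]
    tauto
  rw [this]
  exact Measure.measure_preimage_neg volume _

theorem rpow_head_le_of_density {f : ℝ → ℝ} (hf : Integrable f) (hf0 : ∀ x, 0 ≤ f x)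
    (hLC : ∀ s t y, s ≤ t → t ≤ y → f s * f y ≤ f t * f (s + y - t)) {B : Set ℝ}
    (hB : MeasurableSet B) {l u w δ : ℝ} (hlu : l ≤ u) (huw : u ≤ w) (hδ : 0 < δ)
    (hc : ∀ t, u ≤ t → t ≤ w → volume (B ∩ Set.Icc u t) ≤ ENNReal.ofReal (δ * (t - u))) :
    (∫ x in l..u, f x) ^ δ * (∫ x in l..w, f x) ^ (1 - δ) ≤
      (∫ x in l..u, f x) + ∫ x in u..w, Bᶜ.indicator f x := by
  have h := rpow_tail_le_of_density (f := fun x => f (-x)) (B := (fun x => -x) ⁻¹' B) (w := -w)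
    (v := -u) (r := -l) hf.comp_neg (fun x => hf0 _) (fun s t y h1 h2 => by
      have := hLC (-y) (-t) (-s) (by linarith) (by linarith)
      rw [mul_comm, show -(s + y - t) = -y + -s - -t by ring]
      exact this) (measurable_neg hB) (by linarith) (by linarith) hδ (fun t h1 h2 => by
      rw [volume_preimage_neg_inter_Icc, neg_neg]
      convert hc (-t) (by linarith) (by linarith) using 2
      ring)
  have e : ∀ x, ((fun x : ℝ => -x) ⁻¹' B)ᶜ.indicator (fun x => f (-x)) x =
      (fun y => Bᶜ.indicator f y) (-x) := by
    intro x
    by_cases hx : -x ∈ B <;> simp [hx]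
  simp_rw [e] at h
  rw [intervalIntegral.integral_comp_neg, intervalIntegral.integral_comp_neg,
    intervalIntegral.integral_comp_neg] at h
  simpa using h

theorem setIntegral_inter_Ioc_le_of_antitoneOn {A B : Set ℝ} {w v δ : ℝ} {φ : ℝ → ℝ}
    (hA : IsClosed A) (hB : MeasurableSet B)
    (hAB : Disjoint A B) (hv : v ∈ A) (hδ : 0 ≤ δ)
    (hc : ∀ x ∈ A, v ≤ x → x ≤ w → ∀ t, x ≤ t → t ≤ w →
      volume (B ∩ Set.Icc x t) ≤ ENNReal.ofReal (δ * (t - x)))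
    (hφ : AntitoneOn φ (Set.Ioc v w)) (hφ0 : ∀ x ∈ Set.Ioc v w, 0 ≤ φ x)
    (hφi : IntegrableOn φ (Set.Ioc v w)) :
    ∫ x in Set.Ioc v w ∩ B, φ x ≤ δ * ∫ x in Set.Ioc v w \ A, φ x := by
  have hmp : MeasurePreserving (fun x : ℝ => -x) volume volume :=
    Measure.measurePreserving_neg volume
  have hme : MeasurableEmbedding (fun x : ℝ => -x) := (MeasurableEquiv.neg ℝ).measurableEmbedding
  have eI : Set.Ico (-w) (-v) = (fun x : ℝ => -x) ⁻¹' Set.Ioc v w := by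
    ext x
    simp only [Set.mem_preimage, Set.mem_Ico, Set.mem_Ioc]
    constructor <;> rintro ⟨h1, h2⟩ <;> constructor <;> linarith
  have h := setIntegral_inter_Ico_le_of_monotoneOn (φ := fun x => φ (-x)) (w := -w) (v := -v)
    (hA.preimage continuous_neg) (measurable_neg hB) (hAB.preimage _) (by simpa using hv) hδ
    (fun x hx h1 h2 t h3 h4 => by
      rw [volume_preimage_neg_inter_Icc]
      convert hc (-x) hx (by linarith) (by linarith) (-t) (by linarith) (by linarith) using 2
      ring)
    (fun x hx y hy hxy => hφ (by rw [eI] at hy; exact hy) (by rw [eI] at hx; exact hx)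
      (neg_le_neg hxy))
    (fun x hx => hφ0 _ (by rw [eI] at hx; exact hx))
    (by
      rw [eI]
      exact (hmp.integrableOn_comp_preimage hme).2 hφi)
  rw [eI] at h
  have h1 := hmp.setIntegral_preimage_emb hme φ (Set.Ioc v w ∩ B)
  have h2 := hmp.setIntegral_preimage_emb hme φ (Set.Ioc v w \ A)
  rw [← h1, ← h2]
  exact h

theorem exists_monotone_antitone_split {f : ℝ → ℝ} {A : Set ℝ} {l r : ℝ} (hlr : l ≤ r)
    (hQC : ∀ s t y, s ≤ t → t ≤ y → min (f s) (f y) ≤ f t) (hA : IsClosed A)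
    (hAI : A ⊆ Set.Icc l r) :
    ∃ u v, l ≤ u ∧ u ≤ v ∧ v ≤ r ∧ (∀ x ∈ A, x ≤ u ∨ v ≤ x) ∧
      (u = l ∨ u ∈ A ∧ MonotoneOn f (Set.Ico l u)) ∧
      (v = r ∨ v ∈ A ∧ AntitoneOn f (Set.Ioc v r)) := by
  set L : Set ℝ := {x | x ∈ A ∧ MonotoneOn f (Set.Ico l x)} with hL
  set U : Set ℝ := {x | x ∈ A ∧ AntitoneOn f (Set.Ioc x r)} with hU
  have hLU : ∀ x ∈ A, x ∈ L ∨ x ∈ U := by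
    intro x hx
    by_contra! hcon
    have h1 : ¬ MonotoneOn f (Set.Ico l x) := fun h => hcon.1 ⟨hx, h⟩
    have h2 : ¬ AntitoneOn f (Set.Ioc x r) := fun h => hcon.2 ⟨hx, h⟩
    simp only [MonotoneOn, AntitoneOn, not_forall, not_le, exists_prop] at h1 h2
    obtain ⟨s, hs, t, ht, hst, hts⟩ := h1
    obtain ⟨p, hp, q, hq, hpq, hqp⟩ := h2
    have h3 := hQC s t q hst (ht.2.le.trans hq.1.le)
    have h4 := hQC s p q (hs.2.le.trans hp.1.le) hpq
    rcases min_le_iff.1 h3 with h3 | h3 <;> rcases min_le_iff.1 h4 with h4 | h4 <;> linarith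
  have hLb : BddAbove L := ⟨r, fun x hx => (hAI hx.1).2⟩
  have hUb : BddBelow U := ⟨l, fun x hx => (hAI hx.1).1⟩
  have hLmax : L.Nonempty → sSup L ∈ L := fun hne => by
    refine ⟨hA.closure_subset_iff.2 (fun x hx => hx.1) (csSup_mem_closure hne hLb), ?_⟩
    intro x hx y hy hxy
    obtain ⟨z, hz, hyz⟩ := exists_lt_of_lt_csSup hne hy.2
    exact hz.2 ⟨hx.1, hxy.trans_lt hyz⟩ ⟨hy.1, hyz⟩ hxy
  have hUmin : U.Nonempty → sInf U ∈ U := fun hne => by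
    refine ⟨hA.closure_subset_iff.2 (fun x hx => hx.1) (csInf_mem_closure hne hUb), ?_⟩
    intro x hx y hy hxy
    obtain ⟨z, hz, hzx⟩ := exists_lt_of_csInf_lt hne hx.1
    exact hz.2 ⟨hzx, hx.2⟩ ⟨hzx.trans_le hxy, hy.2⟩ hxy
  rcases L.eq_empty_or_nonempty with hL0 | hL1
  · rcases U.eq_empty_or_nonempty with hU0 | hU1
    · refine ⟨l, r, le_rfl, hlr, le_rfl, fun x hx => ?_, Or.inl rfl, Or.inl rfl⟩
      rcases hLU x hx with h | h
      · simp [hL0] at h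
      · simp [hU0] at h
    · have h := hUmin hU1
      refine ⟨l, sInf U, le_rfl, (hAI h.1).1, (hAI h.1).2, fun x hx => ?_, Or.inl rfl, Or.inr h⟩
      rcases hLU x hx with h | h
      · simp [hL0] at h
      · exact Or.inr (csInf_le hUb h)
  · have h := hLmax hL1
    rcases U.eq_empty_or_nonempty with hU0 | hU1
    · refine ⟨sSup L, r, (hAI h.1).1, (hAI h.1).2, le_rfl, fun x hx => ?_, Or.inr h, Or.inl rfl⟩
      rcases hLU x hx with h | h
      · exact Or.inl (le_csSup hLb h)
      · simp [hU0] at h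
    · have h' := hUmin hU1
      rcases le_total (sSup L) (sInf U) with hle | hle
      · refine ⟨sSup L, sInf U, (hAI h.1).1, hle, (hAI h'.1).2, fun x hx => ?_, Or.inr h,
          Or.inr h'⟩
        exact (hLU x hx).imp (le_csSup hLb) (csInf_le hUb)
      · exact ⟨sSup L, sSup L, (hAI h.1).1, le_rfl, (hAI h.1).2, fun x _ => le_total _ _, Or.inr h,
          Or.inr ⟨h.1, h'.2.mono (Set.Ioc_subset_Ioc_left hle)⟩⟩

theorem rpow_gap_le_of_density {f : ℝ → ℝ} (hf : Integrable f) (hf0 : ∀ x, 0 ≤ f x)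
    (hLC : ∀ s t y, s ≤ t → t ≤ y → f s * f y ≤ f t * f (s + y - t)) {B : Set ℝ}
    (hB : MeasurableSet B) {l u v r δ : ℝ} (hlu : l ≤ u) (huv : u ≤ v) (hvr : v ≤ r) (hδ : 0 < δ)
    (hcu : u = l ∨
      ∀ t, u ≤ t → t ≤ v → volume (B ∩ Set.Icc u t) ≤ ENNReal.ofReal (δ * (t - u)))
    (hcv : v = r ∨
      ∀ t, u ≤ t → t ≤ v → volume (B ∩ Set.Icc t v) ≤ ENNReal.ofReal (δ * (v - t))) :
    ((∫ x in l..u, f x) + ∫ x in v..r, f x) ^ δ * (∫ x in l..r, f x) ^ (1 - δ) ≤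
      (∫ x in l..u, f x) + (∫ x in v..r, f x) + ∫ x in u..v, Bᶜ.indicator f x := by
  have hfi : ∀ a b, IntervalIntegrable f volume a b := fun a b => hf.intervalIntegrable
  have hgi : ∀ a b, IntervalIntegrable (Bᶜ.indicator f) volume a b := fun a b =>
    (hf.indicator hB.compl).intervalIntegrable
  have hg0 : ∀ x, 0 ≤ Bᶜ.indicator f x := fun x => Set.indicator_nonneg (fun _ _ => hf0 _) x
  have hX0 : 0 ≤ ∫ x in u..v, Bᶜ.indicator f x :=
    intervalIntegral.integral_nonneg huv fun x _ => hg0 x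
  have hR1 : 0 ≤ ∫ x in l..u, f x := intervalIntegral.integral_nonneg hlu fun x _ => hf0 x
  have hR2 : 0 ≤ ∫ x in v..r, f x := intervalIntegral.integral_nonneg hvr fun x _ => hf0 x
  have hadd := fun a b c =>
    intervalIntegral.integral_add_adjacent_intervals (hfi a b) (hfi b c)
  rcases hR1.eq_or_lt with h1 | h1
  · rcases hR2.eq_or_lt with h2 | h2
    · rw [← h1, ← h2, zero_add, Real.zero_rpow hδ.ne', zero_mul, zero_add]
      exact hX0
    · have hcv := hcv.resolve_left (by rintro rfl; simp at h2)
      rw [← hadd l u r, ← h1, zero_add, zero_add]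
      exact rpow_tail_le_of_density hf hf0 hLC hB huv hvr hδ hcv
  · have hcu := hcu.resolve_left (by rintro rfl; simp at h1)
    rcases hR2.eq_or_lt with h2 | h2
    · rw [← hadd l v r, ← h2, add_zero, add_zero]
      exact rpow_head_le_of_density hf hf0 hLC hB hlu huv hδ hcu
    · have hcv := hcv.resolve_left (by rintro rfl; simp at h2)
      set R1 := ∫ x in l..u, f x with hR1d
      set R2 := ∫ x in v..r, f x with hR2d
      obtain ⟨w, hw, hweq⟩ : ∃ w ∈ Set.Icc u v,
          R2 * (∫ x in l..w, f x) - R1 * (∫ x in w..r, f x) = 0 := by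
        have hcont : ContinuousOn
            (fun w => R2 * (∫ x in l..w, f x) - R1 * (∫ x in w..r, f x)) (Set.Icc u v) := by
          have c1 : Continuous fun w => ∫ x in l..w, f x :=
            intervalIntegral.continuous_primitive hfi l
          have c2 : Continuous fun w => ∫ x in w..r, f x := by
            simp_rw [fun w => intervalIntegral.integral_symm (f := f) (μ := volume) r w]
            exact (intervalIntegral.continuous_primitive hfi r).neg
          exact ((c1.const_mul _).sub (c2.const_mul _)).continuousOn
        refine intermediate_value_Icc huv hcont ⟨?_, ?_⟩
        · have h3 : R2 ≤ ∫ x in u..r, f x := by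
            rw [← hadd u v r]
            exact le_add_of_nonneg_left (intervalIntegral.integral_nonneg huv fun x _ => hf0 x)
          nlinarith
        · have h3 : R1 ≤ ∫ x in l..v, f x := by
            rw [← hadd l u v]
            exact le_add_of_nonneg_right (intervalIntegral.integral_nonneg huv fun x _ => hf0 x)
          nlinarith
      have t1 := rpow_head_le_of_density hf hf0 hLC hB hlu hw.1 hδ
        fun t h1 h2 => hcu t h1 (h2.trans hw.2)
      have t2 := rpow_tail_le_of_density hf hf0 hLC hB hw.2 hvr hδ
        fun t h1 h2 => hcv t (hw.1.trans h1) h2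
      rw [← intervalIntegral.integral_add_adjacent_intervals (hgi u w) (hgi w v)]
      rw [← hR1d] at t1
      rw [← hR2d] at t2
      set P := ∫ x in l..w, f x with hP
      set Q := ∫ x in w..r, f x with hQ
      have hT : ∫ x in l..r, f x = P + Q := (hadd l w r).symm
      have hP0 : 0 < P := by
        rw [hP, ← hadd l u w]
        exact add_pos_of_pos_of_nonneg h1
          (intervalIntegral.integral_nonneg hw.1 fun x _ => hf0 x)
      have hPe : P = R1 * ((P + Q) / (R1 + R2)) := by
        field_simp
        linarith
      have hQe : Q = R2 * ((P + Q) / (R1 + R2)) := by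
        field_simp
        linarith
      have hQ0 : 0 ≤ Q := intervalIntegral.integral_nonneg (hw.2.trans hvr) fun x _ => hf0 x
      have key : ∀ a c : ℝ, 0 < a → 0 ≤ c → a ^ δ * (a * c) ^ (1 - δ) = a * c ^ (1 - δ) := by
        intro a c ha hc
        rw [Real.mul_rpow ha.le hc, ← mul_assoc, ← Real.rpow_add ha]
        norm_num
      have hc0 : 0 ≤ (P + Q) / (R1 + R2) := by positivity
      have hTe : P + Q = (R1 + R2) * ((P + Q) / (R1 + R2)) := by field_simp
      rw [hPe, key _ _ h1 hc0] at t1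
      rw [hQe, key _ _ h2 hc0] at t2
      rw [hT, hTe, key _ _ (by positivity) hc0]
      linarith

theorem intervalIntegral_indicator_eq_Ioc {f : ℝ → ℝ} {D : Set ℝ} (hD : MeasurableSet D) {a b : ℝ}
    (hab : a ≤ b) : ∫ x in a..b, D.indicator f x = ∫ x in Set.Ioc a b ∩ D, f x := by
  rw [intervalIntegral.integral_of_le hab, setIntegral_indicator hD]

theorem intervalIntegral_indicator_eq_Ico {f : ℝ → ℝ} {D : Set ℝ} (hD : MeasurableSet D) {a b : ℝ}
    (hab : a ≤ b) : ∫ x in a..b, D.indicator f x = ∫ x in Set.Ico a b ∩ D, f x := by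
  rw [intervalIntegral.integral_of_le hab, ← integral_Ico_eq_integral_Ioc, setIntegral_indicator hD]

theorem rpow_mul_rpow_le_of_le {a R X T δ : ℝ} (ha : 0 ≤ a) (haR : a ≤ R) (hX : 0 ≤ X)
    (hδ : 0 < δ) (hδ1 : δ ≤ 1) (h : R ^ δ * T ^ (1 - δ) ≤ R + X) :
    a ^ δ * T ^ (1 - δ) ≤ (1 - δ) * R + δ * a + X := by
  rcases (ha.trans haR).eq_or_lt with hR | hR
  · have : a = 0 := le_antisymm (hR ▸ haR) ha
    rw [this, ← hR, Real.zero_rpow hδ.ne']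
    simpa using hX
  set α := a / R with hα
  have hα0 : 0 ≤ α := by positivity
  have hα1 : α ≤ 1 := (div_le_one hR).2 haR
  have haα : a = α * R := by rw [hα]; field_simp
  have h1 : α ^ δ ≤ (1 - δ) + δ * α := by
    have := Real.geom_mean_le_arith_mean2_weighted hδ.le (sub_nonneg.2 hδ1) hα0 zero_le_one
      (by ring)
    rw [Real.one_rpow] at this
    linarith
  have h2 : α ^ δ ≤ 1 := Real.rpow_le_one hα0 hα1 hδ.le
  have h3 : 0 ≤ α ^ δ := Real.rpow_nonneg hα0 _
  rw [haα, Real.mul_rpow hα0 hR.le, mul_assoc]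
  calc α ^ δ * (R ^ δ * T ^ (1 - δ)) ≤ α ^ δ * (R + X) := by gcongr
    _ ≤ _ := by nlinarith

/-- The one-dimensional case, for log-concave densities: `A` lies in the `δ`-core of the complement
of `B` inside `[l, r]`. -/
theorem rpow_setIntegral_mul_le_of_density {f : ℝ → ℝ} (hf : Integrable f) (hf0 : ∀ x, 0 ≤ f x)
    (hLC : ∀ s t y, s ≤ t → t ≤ y → f s * f y ≤ f t * f (s + y - t))
    (hQC : ∀ s t y, s ≤ t → t ≤ y → min (f s) (f y) ≤ f t) {A B : Set ℝ} {l r δ : ℝ}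
    (hlr : l ≤ r) (hA : IsClosed A) (hAI : A ⊆ Set.Icc l r) (hB : MeasurableSet B)
    (hAB : Disjoint A B) (hδ : 0 < δ) (hδ1 : δ ≤ 1)
    (hc : ∀ x ∈ A, ∀ t ∈ Set.Icc l r,
      volume (B ∩ Set.uIcc t x) ≤ ENNReal.ofReal (δ * |x - t|)) :
    (∫ x in A, f x) ^ δ * (∫ x in l..r, f x) ^ (1 - δ) ≤ ∫ x in l..r, Bᶜ.indicator f x := by
  obtain ⟨u, v, hlu, huv, hvr, hgap, hu, hv⟩ := exists_monotone_antitone_split hlr hQC hA hAI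
  have hcl : ∀ x ∈ A, ∀ t, l ≤ t → t ≤ x →
      volume (B ∩ Set.Icc t x) ≤ ENNReal.ofReal (δ * (x - t)) := fun x hx t h1 h2 => by
    have := hc x hx t ⟨h1, h2.trans (hAI hx).2⟩
    rwa [Set.uIcc_of_le h2, abs_of_nonneg (sub_nonneg.2 h2)] at this
  have hcr : ∀ x ∈ A, ∀ t, x ≤ t → t ≤ r →
      volume (B ∩ Set.Icc x t) ≤ ENNReal.ofReal (δ * (t - x)) := fun x hx t h1 h2 => by
    have := hc x hx t ⟨(hAI hx).1.trans h1, h2⟩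
    rwa [Set.uIcc_of_ge h1, abs_sub_comm, abs_of_nonneg (sub_nonneg.2 h1)] at this
  have hgap' := rpow_gap_le_of_density hf hf0 hLC hB hlu huv hvr hδ
    (hu.imp_right fun h t h1 h2 => hcr u h.1 t h1 (h2.trans hvr))
    (hv.imp_right fun h t h1 h2 => hcl v h.1 t (hlu.trans h1) h2)
  have hind : ∀ D : Set ℝ, MeasurableSet D → ∀ a b,
      IntervalIntegrable (D.indicator f) volume a b :=
    fun D hD a b => (hf.indicator hD).intervalIntegrable
  have hle : ∀ D : Set ℝ, MeasurableSet D → ∀ a b, a ≤ b →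
      ∫ x in a..b, D.indicator f x ≤ ∫ x in a..b, f x := fun D hD a b hab =>
    intervalIntegral.integral_mono_on hab (hind D hD a b) hf.intervalIntegrable
      fun x _ => Set.indicator_le_self' (fun _ _ => hf0 _) x
  have hnn : ∀ (D : Set ℝ) a b, a ≤ b → 0 ≤ ∫ x in a..b, D.indicator f x := fun D a b hab =>
    intervalIntegral.integral_nonneg hab fun x _ => Set.indicator_nonneg (fun _ _ => hf0 _) x
  have hsplit : ∀ D : Set ℝ, MeasurableSet D → ∫ x in l..r, D.indicator f x =
      (∫ x in l..u, D.indicator f x) + (∫ x in u..v, D.indicator f x) +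
        ∫ x in v..r, D.indicator f x := fun D hD => by
    rw [intervalIntegral.integral_add_adjacent_intervals (hind D hD _ _) (hind D hD _ _),
      intervalIntegral.integral_add_adjacent_intervals (hind D hD _ _) (hind D hD _ _)]
  have hAm := hA.measurableSet
  have hmid : ∫ x in u..v, A.indicator f x = 0 := by
    rw [intervalIntegral.integral_of_le huv, integral_Ioc_eq_integral_Ioo]
    refine setIntegral_eq_zero_of_forall_eq_zero fun x hx => Set.indicator_of_notMem ?_ _
    intro hxA
    rcases hgap x hxA with h | h
    · exact absurd h (not_le.2 hx.1)
    · exact absurd h (not_le.2 hx.2)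
  have hAa : ∫ x in A, f x = ∫ x in l..r, A.indicator f x := by
    rw [intervalIntegral.integral_of_le hlr, ← integral_Icc_eq_integral_Ioc,
      setIntegral_indicator hAm, Set.inter_eq_right.2 hAI]
  have hcompl : ∀ (D : Set ℝ) (S : Set ℝ), MeasurableSet D →
      (∫ x in S ∩ D, f x) + ∫ x in S ∩ Dᶜ, f x = ∫ x in S, f x := fun D S hD => by
    rw [← Set.sdiff_eq]
    exact integral_inter_add_sdiff hD hf.integrableOn
  have hleft : (1 - δ) * (∫ x in l..u, f x) + δ * (∫ x in l..u, A.indicator f x) ≤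
      ∫ x in l..u, Bᶜ.indicator f x := by
    rcases hu with rfl | ⟨huA, hmono⟩
    · simp
    have h := setIntegral_inter_Ico_le_of_monotoneOn (w := l) hA hB hAB huA hδ.le
      (fun x hx h1 _ t h3 h4 => hcl x hx t h3 h4) hmono (fun x _ => hf0 x) hf.integrableOn
    rw [intervalIntegral_indicator_eq_Ico hAm hlu, intervalIntegral_indicator_eq_Ico hB.compl hlu,
      intervalIntegral.integral_of_le hlu, ← integral_Ico_eq_integral_Ioc]
    have h1 := hcompl A (Set.Ico l u) hAm
    have h2 := hcompl B (Set.Ico l u) hB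
    rw [Set.sdiff_eq] at h
    rw [← h1] at h2 ⊢
    linarith
  have hright : (1 - δ) * (∫ x in v..r, f x) + δ * (∫ x in v..r, A.indicator f x) ≤
      ∫ x in v..r, Bᶜ.indicator f x := by
    rcases hv with rfl | ⟨hvA, hanti⟩
    · simp
    have h := setIntegral_inter_Ioc_le_of_antitoneOn (w := r) hA hB hAB hvA hδ.le
      (fun x hx _ _ t h3 h4 => hcr x hx t h3 h4) hanti (fun x _ => hf0 x) hf.integrableOn
    rw [intervalIntegral_indicator_eq_Ioc hAm hvr, intervalIntegral_indicator_eq_Ioc hB.compl hvr,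
      intervalIntegral.integral_of_le hvr]
    have h1 := hcompl A (Set.Ioc v r) hAm
    have h2 := hcompl B (Set.Ioc v r) hB
    rw [Set.sdiff_eq] at h
    rw [← h1] at h2 ⊢
    linarith

  have ha := hsplit A hAm
  rw [hmid, add_zero, ← hAa] at ha
  have hfin := rpow_mul_rpow_le_of_le (a := ∫ x in A, f x) (by rw [hAa]; exact hnn A l r hlr)
    (by rw [ha]; exact add_le_add (hle A hAm l u hlu) (hle A hAm v r hvr)) (hnn Bᶜ u v huv)
    hδ hδ1 hgap'
  refine hfin.trans ?_
  rw [hsplit Bᶜ hB.compl, ha]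
  linarith

theorem mul_le_mul_of_rpow_mul_rpow_le {f : ℝ → ℝ} (hf0 : ∀ x, 0 ≤ f x)
    (h : ∀ a b : ℝ, 0 < a → 0 < b → a + b = 1 → ∀ x y, f x ^ a * f y ^ b ≤ f (a * x + b * y))
    (s t y : ℝ) (hst : s ≤ t) (hty : t ≤ y) : f s * f y ≤ f t * f (s + y - t) := by
  rcases hst.eq_or_lt with rfl | hst
  · rw [add_sub_cancel_left]
  rcases hty.eq_or_lt with rfl | hty
  · rw [add_sub_cancel_right, mul_comm]
  have hsy : 0 < y - s := by linarith
  set a := (y - t) / (y - s) with ha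
  set b := (t - s) / (y - s) with hb
  have ha0 : 0 < a := div_pos (by linarith) hsy
  have hb0 : 0 < b := div_pos (by linarith) hsy
  have hab : a + b = 1 := by rw [ha, hb]; field_simp; ring
  have h1 := h a b ha0 hb0 hab s y
  have h2 := h b a hb0 ha0 (by linarith) s y
  have e1 : a * s + b * y = t := by rw [ha, hb]; field_simp; ring
  have e2 : b * s + a * y = s + y - t := by rw [ha, hb]; field_simp; ring
  rw [e1] at h1
  rw [e2] at h2
  have key : ∀ z : ℝ, 0 ≤ z → z ^ a * z ^ b = z := fun z hz => by
    rw [← Real.rpow_add_of_nonneg hz ha0.le hb0.le, hab, Real.rpow_one]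
  calc f s * f y = (f s ^ a * f s ^ b) * (f y ^ a * f y ^ b) := by
        rw [key _ (hf0 _), key _ (hf0 _)]
    _ = (f s ^ a * f y ^ b) * (f s ^ b * f y ^ a) := by ring
    _ ≤ f t * f (s + y - t) := by
        have := hf0 s
        have := hf0 y
        have := hf0 t
        gcongr

theorem min_le_of_rpow_mul_rpow_le {f : ℝ → ℝ} (hf0 : ∀ x, 0 ≤ f x)
    (h : ∀ a b : ℝ, 0 < a → 0 < b → a + b = 1 → ∀ x y, f x ^ a * f y ^ b ≤ f (a * x + b * y))
    (s t y : ℝ) (hst : s ≤ t) (hty : t ≤ y) : min (f s) (f y) ≤ f t := by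
  rcases hst.eq_or_lt with rfl | hst
  · exact min_le_left _ _
  rcases hty.eq_or_lt with rfl | hty
  · exact min_le_right _ _
  have hsy : 0 < y - s := by linarith
  have ha0 : 0 < (y - t) / (y - s) := div_pos (by linarith) hsy
  have hb0 : 0 < (t - s) / (y - s) := div_pos (by linarith) hsy
  have hab : (y - t) / (y - s) + (t - s) / (y - s) = 1 := by field_simp; ring
  have h1 := h _ _ ha0 hb0 hab s y
  have e1 : (y - t) / (y - s) * s + (t - s) / (y - s) * y = t := by field_simp; ring
  rw [e1] at h1
  refine le_trans ?_ h1
  have hm : 0 ≤ min (f s) (f y) := le_min (hf0 _) (hf0 _)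
  calc min (f s) (f y) = min (f s) (f y) ^ ((y - t) / (y - s)) *
        min (f s) (f y) ^ ((t - s) / (y - s)) := by
        rw [← Real.rpow_add_of_nonneg hm ha0.le hb0.le, hab, Real.rpow_one]
    _ ≤ _ := by
        gcongr
        · exact Real.rpow_nonneg (hf0 s) _
        · exact min_le_left _ _
        · exact min_le_right _ _

/-- The slice of `K` where the `i`-th coordinate equals `s`. -/
def coordSlice {m : ℕ} (K : Set (EuclideanSpace ℝ (Fin (m + 1)))) (i : Fin (m + 1)) (s : ℝ) :
    Set (Fin m → ℝ) :=
  {y | WithLp.toLp 2 (i.insertNth (α := fun _ => ℝ) s y) ∈ K}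

theorem measurable_volume_coordSlice_and_lintegral {m : ℕ} {K : Set (EuclideanSpace ℝ (Fin (m + 1)))}
    (hK : MeasurableSet K) (i : Fin (m + 1)) :
    Measurable (fun s => volume (coordSlice K i s)) ∧ ∀ S : Set ℝ, MeasurableSet S →
      volume (K ∩ {x | x i ∈ S}) = ∫⁻ s in S, volume (coordSlice K i s) := by
  have hm : Measurable fun p : ℝ × (Fin m → ℝ) =>
      (WithLp.toLp 2 (i.insertNth (α := fun _ => ℝ) p.1 p.2) : EuclideanSpace ℝ (Fin (m + 1))) :=
    (WithLp.measurable_toLp 2 _).comp (measurable_insertNth i)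
  have hS : MeasurableSet {p : ℝ × (Fin m → ℝ) |
      (WithLp.toLp 2 (i.insertNth (α := fun _ => ℝ) p.1 p.2) : EuclideanSpace ℝ (Fin (m + 1))) ∈ K} :=
    hm hK
  refine ⟨measurable_measure_prodMk_left hS, fun S hSm => ?_⟩
  have hev : Measurable fun x : EuclideanSpace ℝ (Fin (m + 1)) => x i := by fun_prop
  have hT : MeasurableSet (K ∩ {x | x i ∈ S}) := hK.inter (hev hSm)
  have hmp := PiLp.volume_preserving_toLp (Fin (m + 1))
  rw [← hmp.measure_preimage hT.nullMeasurableSet, ← lintegral_indicator_one (hmp.measurable hT),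
    lintegral_fin_succ_insertNth i (measurable_one.indicator (hmp.measurable hT)),
    ← lintegral_indicator hSm]
  refine lintegral_congr fun s => ?_
  by_cases hs : s ∈ S
  · have hsl : MeasurableSet (coordSlice K i s) := measurable_prodMk_left hS
    rw [Set.indicator_of_mem hs, ← lintegral_indicator_one hsl]
    refine lintegral_congr fun y => ?_
    refine Set.indicator_eq_indicator ?_ rfl
    simp [coordSlice, hs]
  · rw [Set.indicator_of_notMem hs]
    refine lintegral_eq_zero_of_ae_eq_zero (Filter.Eventually.of_forall fun y => ?_)
    simp [hs]

theorem volume_coordSlice_lt_top {m : ℕ} {K : Set (EuclideanSpace ℝ (Fin (m + 1)))}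
    (hK : IsCompact K) (i : Fin (m + 1)) (s : ℝ) : volume (coordSlice K i s) < ⊤ := by
  have hc : Continuous fun x : EuclideanSpace ℝ (Fin (m + 1)) => fun j => x (i.succAbove j) := by
    fun_prop
  refine lt_of_le_of_lt (measure_mono ?_) (hK.image hc).measure_lt_top
  intro y hy
  exact ⟨_, hy, by ext j; simp⟩

theorem rpow_volume_coordSlice_le {m : ℕ} {K : Set (EuclideanSpace ℝ (Fin (m + 1)))}
    (hK : IsCompact K) (hKc : Convex ℝ K) (i : Fin (m + 1)) (a b : ℝ) (ha : 0 < a) (hb : 0 < b)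
    (hab : a + b = 1) (s t : ℝ) :
    (volume (coordSlice K i s)).toReal ^ a * (volume (coordSlice K i t)).toReal ^ b ≤
      (volume (coordSlice K i (a * s + b * t))).toReal := by
  have hm : ∀ s, MeasurableSet (coordSlice K i s) := fun s => by
    have h1 : Measurable fun y : Fin m → ℝ =>
        (WithLp.toLp 2 (i.insertNth (α := fun _ => ℝ) s y) : EuclideanSpace ℝ (Fin (m + 1))) :=
      (WithLp.measurable_toLp 2 _).comp ((measurable_insertNth i).comp measurable_prodMk_left)
    exact h1 hK.measurableSet
  have hsub : ∀ x ∈ coordSlice K i s, ∀ y ∈ coordSlice K i t,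
      a • x + b • y ∈ coordSlice K i (a * s + b * t) := by
    intro x hx y hy
    have := hKc hx hy ha.le hb.le hab
    change WithLp.toLp 2 _ ∈ K
    convert this using 1
    ext j
    refine Fin.succAboveCases i ?_ (fun k => ?_) j <;> simp
  have key := prekopa_leindler ha hb hab (measurable_one.indicator (hm s)) (measurable_one.indicator (hm t))
    (measurable_one.indicator (hm (a * s + b * t))) (by
      intro x y
      by_cases hx : x ∈ coordSlice K i s
      · by_cases hy : y ∈ coordSlice K i t
        · simp [hx, hy, hsub x hx y hy]
        · simp [hy, hb]
      · simp [hx, ha])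
  rw [lintegral_indicator_one (hm _), lintegral_indicator_one (hm _),
    lintegral_indicator_one (hm _)] at key
  have := ENNReal.toReal_mono (volume_coordSlice_lt_top hK i _).ne key
  rwa [ENNReal.toReal_mul, ← ENNReal.toReal_rpow, ← ENNReal.toReal_rpow] at this

theorem volume_inter_uIcc_eq_abs_integral {B : Set ℝ} (hB : MeasurableSet B) (t s : ℝ) :
    volume (B ∩ Set.uIcc t s) = ENNReal.ofReal |∫ x in t..s, B.indicator 1 x| := by
  wlog h : t ≤ s generalizing t s
  · rw [Set.uIcc_comm, intervalIntegral.integral_symm, abs_neg]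
    exact this s t (le_of_not_ge h)
  have h1 : ∫ x in t..s, B.indicator (1 : ℝ → ℝ) x = (volume (B ∩ Set.Icc t s)).toReal := by
    rw [intervalIntegral.integral_of_le h, ← integral_Icc_eq_integral_Ioc,
      integral_indicator_one hB, measureReal_restrict_apply hB, measureReal_def]
  rw [h1, abs_of_nonneg ENNReal.toReal_nonneg, Set.uIcc_of_le h, ENNReal.ofReal_toReal]
  exact ((measure_mono Set.inter_subset_right).trans_lt measure_Icc_lt_top).ne

theorem volume_compl_image_inter_uIcc_le {n : ℕ} {F E K : Set (EuclideanSpace ℝ (Fin n))}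
    (hE : IsClosed E) (hK : IsCompact K) (hKc : Convex ℝ K) (hKF : K ⊆ F) {lam : ℝ} (hlam : 1 < lam)
    (i : Fin n) {x z : EuclideanSpace ℝ (Fin n)} (hx : x ∈ core E F lam) (hxK : x ∈ K)
    (hzK : z ∈ K) :
    volume (((fun x : EuclideanSpace ℝ (Fin n) => x i) '' (E ∩ K))ᶜ ∩ Set.uIcc (z i) (x i)) ≤
      ENNReal.ofReal (lam⁻¹ * |x i - z i|) := by
  rcases eq_or_ne (x i) (z i) with h | h
  · rw [← h, Set.uIcc_self]
    exact (measure_mono Set.inter_subset_right).trans (by simp)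
  have hseg : segment ℝ z x ⊆ K := hKc.segment_subset hzK hxK
  have hcore := hx.2 z x (right_mem_segment ℝ z x) (hseg.trans hKF)
  have hd : 0 < dist z x := dist_pos.2 fun e => h (by rw [e])
  set T := {t : ℝ | t ∈ Set.Icc (0 : ℝ) 1 ∧ z + t • (x - z) ∈ E} with hT
  set E' := (fun x : EuclideanSpace ℝ (Fin n) => x i) '' (E ∩ K) with hE'
  have hE'c : IsCompact E' := (hK.inter_left hE).image (by fun_prop)
  have hTv : 1 - lam⁻¹ ≤ (volume T).toReal := by
    unfold segmentMeasure at hcore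
    rw [mul_comm] at hcore
    have := le_of_mul_le_mul_left hcore hd
    rwa [sub_div, div_self (by positivity), one_div] at this
  set S := E' ∩ Set.uIcc (z i) (x i) with hS
  have hSm : MeasurableSet S := hE'c.measurableSet.inter measurableSet_uIcc
  have hsub : T ⊆ (fun τ => τ * (x i - z i)) ⁻¹' ((fun y => y + z i) ⁻¹' S) := by
    rintro τ ⟨hτ, hτE⟩
    have hmem : z + τ • (x - z) ∈ segment ℝ z x := by
      rw [segment_eq_image']
      exact ⟨τ, hτ, rfl⟩
    have e : (z + τ • (x - z)) i = τ * (x i - z i) + z i := by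
      simp [add_comm]
    refine ⟨⟨z + τ • (x - z), ⟨hτE, hseg hmem⟩, e⟩, ?_⟩
    have : τ * (x i - z i) + z i ∈ segment ℝ (z i) (x i) := by
      rw [segment_eq_image']
      exact ⟨τ, hτ, by simp [add_comm]⟩
    rwa [segment_eq_uIcc] at this
  have hfin : volume S ≠ ⊤ :=
    ((measure_mono Set.inter_subset_right).trans_lt isCompact_uIcc.measure_lt_top).ne
  have hpos : 0 < |x i - z i| := abs_pos.2 (sub_ne_zero.2 h)
  have hSv : (1 - lam⁻¹) * |x i - z i| ≤ (volume S).toReal := by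
    have h1 := measure_mono (μ := volume) hsub
    rw [Real.volume_preimage_mul_right (sub_ne_zero.2 h), measure_preimage_add_right] at h1
    have h2 := ENNReal.toReal_mono (by finiteness) h1
    rw [ENNReal.toReal_mul, ENNReal.toReal_ofReal (abs_nonneg _), abs_inv] at h2
    have h3 := hTv.trans h2
    rwa [inv_mul_eq_div, le_div_iff₀ hpos] at h3
  have hsplit := measure_inter_add_sdiff (μ := volume) (Set.uIcc (z i) (x i)) hE'c.measurableSet
  rw [Set.sdiff_eq, Set.inter_comm _ E', Set.inter_comm _ E'ᶜ, Real.volume_interval] at hsplit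
  have hfin2 : volume (E'ᶜ ∩ Set.uIcc (z i) (x i)) ≠ ⊤ :=
    ((measure_mono Set.inter_subset_right).trans_lt isCompact_uIcc.measure_lt_top).ne
  have h4 := congrArg ENNReal.toReal hsplit
  rw [ENNReal.toReal_add hfin hfin2, ENNReal.toReal_ofReal (abs_nonneg _)] at h4
  rw [← ENNReal.ofReal_toReal hfin2]
  refine ENNReal.ofReal_le_ofReal ?_
  linarith

/-- The localized inequality on a convex set `K` on which membership in `E` propagates to
membership in `D` along the fibres of a coordinate. -/
theorem rpow_volume_core_inter_le_of_fibres {m : ℕ} {F E D K : Set (EuclideanSpace ℝ (Fin (m + 1)))}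
    (hE : IsClosed E) (hK : IsCompact K) (hKc : Convex ℝ K) (hKF : K ⊆ F) {lam : ℝ} (hlam : 1 < lam)
    (i : Fin (m + 1)) (hD : ∀ x ∈ K, ∀ y ∈ K, y ∈ E → x i = y i → x ∈ D) :
    (volume (core E F lam ∩ K)).toReal ^ lam⁻¹ * (volume K).toReal ^ (1 - lam⁻¹) ≤
      (volume (D ∩ K)).toReal := by
  have hlam0 : 0 < lam := by linarith
  have hδ : 0 < lam⁻¹ := inv_pos.2 hlam0
  have hδ1 : lam⁻¹ ≤ 1 := inv_le_one_of_one_le₀ hlam.le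
  rcases K.eq_empty_or_nonempty with hK0 | hKne
  · simp [hK0, Real.zero_rpow hδ.ne']
  have hev : Continuous fun x : EuclideanSpace ℝ (Fin (m + 1)) => x i := by fun_prop
  obtain ⟨p, hpK, hp⟩ := hK.exists_isMinOn hKne hev.continuousOn
  obtain ⟨q, hqK, hq⟩ := hK.exists_isMaxOn hKne hev.continuousOn
  set l := p i with hl
  set r := q i with hr
  have hlr : l ≤ r := hp hqK
  have hKI : ∀ x ∈ K, x i ∈ Set.Icc l r := fun x hx => ⟨hp hx, hq hx⟩
  have himg : ∀ t ∈ Set.Icc l r, ∃ z ∈ K, z i = t := by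
    have := (hKc.isPreconnected.image _ hev.continuousOn).ordConnected.out
      (Set.mem_image_of_mem _ hpK) (Set.mem_image_of_mem _ hqK)
    exact fun t ht => this ht
  set E' := (fun x : EuclideanSpace ℝ (Fin (m + 1)) => x i) '' (E ∩ K) with hE'
  have hE'c : IsCompact E' := (hK.inter_left hE).image hev
  set B := E'ᶜ with hB
  have hBm : MeasurableSet B := hE'c.measurableSet.compl
  set A' : Set ℝ := {s | s ∈ E' ∩ Set.Icc l r ∧ ∀ t ∈ Set.Icc l r,
    volume (B ∩ Set.uIcc t s) ≤ ENNReal.ofReal (lam⁻¹ * |s - t|)} with hA'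
  have hA'c : IsClosed A' := by
    have : A' = (E' ∩ Set.Icc l r) ∩ ⋂ t ∈ Set.Icc l r,
        {s | ENNReal.ofReal |∫ x in t..s, B.indicator (1 : ℝ → ℝ) x| ≤
          ENNReal.ofReal (lam⁻¹ * |s - t|)} := by
      ext s
      simp only [hA', volume_inter_uIcc_eq_abs_integral hBm, Set.mem_inter_iff, Set.mem_iInter,
        Set.mem_ofPred_eq]
    rw [this]
    refine (hE'c.isClosed.inter isClosed_Icc).inter (isClosed_biInter fun t _ => ?_)
    refine isClosed_le ?_ ?_
    · refine ENNReal.continuous_ofReal.comp (Continuous.abs ?_)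
      refine intervalIntegral.continuous_primitive (fun a b => ?_) t
      exact (intervalIntegrable_const (c := (1 : ℝ))).mono_fun'
        ((measurable_one.indicator hBm).aestronglyMeasurable)
        (Filter.Eventually.of_forall fun x => by
          by_cases hx : x ∈ B <;> simp [hx])
    · exact ENNReal.continuous_ofReal.comp (by fun_prop)
  have hcoreA : core E F lam ∩ K ⊆ K ∩ {x | x i ∈ A'} := by
    rintro x ⟨hx, hxK⟩
    refine ⟨hxK, ⟨⟨x, ⟨hx.1, hxK⟩, rfl⟩, hKI x hxK⟩, fun t ht => ?_⟩
    obtain ⟨z, hzK, rfl⟩ := himg t ht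
    exact volume_compl_image_inter_uIcc_le hE hK hKc hKF hlam i hx hxK hzK
  obtain ⟨hfm, hslice⟩ := measurable_volume_coordSlice_and_lintegral hK.measurableSet i
  set f : ℝ → ℝ := fun s => (volume (coordSlice K i s)).toReal with hf
  have hslice' : ∀ S : Set ℝ, MeasurableSet S →
      ∫ s in S, f s = (volume (K ∩ {x | x i ∈ S})).toReal := fun S hS => by
    rw [hslice S hS]
    exact integral_toReal hfm.aemeasurable
      (Filter.Eventually.of_forall fun s => volume_coordSlice_lt_top hK i s)
  have hfi : Integrable f := by
    refine integrable_toReal_of_lintegral_ne_top hfm.aemeasurable ?_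
    rw [← setLIntegral_univ, ← hslice _ MeasurableSet.univ]
    exact ((measure_mono Set.inter_subset_left).trans_lt hK.measure_lt_top).ne
  have hf0 : ∀ x, 0 ≤ f x := fun x => ENNReal.toReal_nonneg
  have hlc := rpow_volume_coordSlice_le hK hKc i
  have key := rpow_setIntegral_mul_le_of_density hfi hf0
    (mul_le_mul_of_rpow_mul_rpow_le hf0 hlc) (min_le_of_rpow_mul_rpow_le hf0 hlc) hlr hA'c
    (fun s hs => hs.1.2) hBm (Set.disjoint_left.2 fun s hs h => h hs.1.1) hδ hδ1
    (fun s hs t ht => hs.2 t ht)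
  have hKfin : ∀ S ⊆ K, volume S ≠ ⊤ := fun S hS =>
    ((measure_mono hS).trans_lt hK.measure_lt_top).ne
  have e1 : ∫ s in l..r, f s = (volume K).toReal := by
    rw [intervalIntegral.integral_of_le hlr, ← integral_Icc_eq_integral_Ioc,
      hslice' _ measurableSet_Icc, Set.inter_eq_left.2 (show K ⊆ {x | x i ∈ Set.Icc l r} from hKI)]
  have e2 : ∫ s in l..r, Bᶜ.indicator f s ≤ (volume (D ∩ K)).toReal := by
    rw [intervalIntegral.integral_of_le hlr, ← integral_Icc_eq_integral_Ioc,
      setIntegral_indicator hBm.compl, hslice' _ (measurableSet_Icc.inter hBm.compl)]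
    refine ENNReal.toReal_mono (hKfin _ Set.inter_subset_right) (measure_mono ?_)
    rintro x ⟨hxK, -, hxB⟩
    rw [hB, compl_compl] at hxB
    obtain ⟨y, ⟨hyE, hyK⟩, hyx⟩ := hxB
    exact ⟨hD x hxK y hyK hyE hyx.symm, hxK⟩
  have e3 : (volume (core E F lam ∩ K)).toReal ≤ ∫ s in A', f s := by
    rw [hslice' _ hA'c.measurableSet]
    exact ENNReal.toReal_mono (hKfin _ Set.inter_subset_left) (measure_mono hcoreA)
  rw [e1] at key
  refine le_trans ?_ (key.trans e2)
  gcongr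

theorem volume_affine_line_eq_zero {n : ℕ} {i j : Fin n} (hij : i ≠ j) {a b : ℝ}
    (hab : a ^ 2 + b ^ 2 = 1) (α β : ℝ) :
    volume {x : EuclideanSpace ℝ (Fin n) | a * (x i - α) + b * (x j - β) = 0} = 0 := by
  set φ : EuclideanSpace ℝ (Fin n) →ₗ[ℝ] ℝ :=
    (a • EuclideanSpace.proj (𝕜 := ℝ) i + b • EuclideanSpace.proj j :
      EuclideanSpace ℝ (Fin n) →L[ℝ] ℝ).toLinearMap with hφ
  have hφx : ∀ x, φ x = a * x i + b * x j := fun x => by simp [hφ]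
  set z : EuclideanSpace ℝ (Fin n) :=
    EuclideanSpace.single i α + EuclideanSpace.single j β with hz
  have hzi : z i = α := by simp [hz, hij]
  have hzj : z j = β := by simp [hz, hij.symm]
  have hker : LinearMap.ker φ ≠ ⊤ := by
    intro h
    have h1 : EuclideanSpace.single i a + EuclideanSpace.single j b ∈ LinearMap.ker φ :=
      h ▸ Submodule.mem_top
    rw [LinearMap.mem_ker, hφx] at h1
    simp [hij, hij.symm] at h1
    nlinarith
  have hset : {x : EuclideanSpace ℝ (Fin n) | a * (x i - α) + b * (x j - β) = 0} =
      (fun x => x + -z) ⁻¹' (LinearMap.ker φ : Set (EuclideanSpace ℝ (Fin n))) := by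
    ext x
    rw [Set.mem_preimage, SetLike.mem_coe, LinearMap.mem_ker, hφx, Set.mem_ofPred_eq]
    simp only [PiLp.add_apply, PiLp.neg_apply, hzi, hzj, sub_eq_add_neg]
  rw [hset, measure_preimage_add_right]
  exact Measure.addHaar_submodule _ _ hker

/-- The closed half-space whose boundary passes over `(α, β)` in the coordinates `i, j`, with outer
normal at angle `θ`. -/
def rotHalf {n : ℕ} (i j : Fin n) (α β θ : ℝ) : Set (EuclideanSpace ℝ (Fin n)) :=
  {x | Real.cos θ * (x i - α) + Real.sin θ * (x j - β) ≤ 0}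

theorem isClosed_rotHalf {n : ℕ} (i j : Fin n) (α β θ : ℝ) : IsClosed (rotHalf i j α β θ) :=
  isClosed_le (by fun_prop) continuous_const

theorem convex_rotHalf {n : ℕ} (i j : Fin n) (α β θ : ℝ) : Convex ℝ (rotHalf i j α β θ) := by
  intro x hx y hy s t hs ht hst
  simp only [rotHalf, Set.mem_ofPred_eq] at hx hy ⊢
  have h1 := mul_nonpos_of_nonneg_of_nonpos hs hx
  have h2 := mul_nonpos_of_nonneg_of_nonpos ht hy
  simp only [PiLp.add_apply, PiLp.smul_apply, smul_eq_mul]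
  have e : Real.cos θ * (s * x i + t * y i - α) + Real.sin θ * (s * x j + t * y j - β) =
      s * (Real.cos θ * (x i - α) + Real.sin θ * (x j - β)) +
        t * (Real.cos θ * (y i - α) + Real.sin θ * (y j - β)) := by
    have : t = 1 - s := by linarith
    rw [this]
    ring
  rw [e]
  linarith

theorem continuous_volume_inter_rotHalf {n : ℕ} {i j : Fin n} (hij : i ≠ j) (α β : ℝ)
    {S : Set (EuclideanSpace ℝ (Fin n))} (hS : volume S ≠ ⊤) :
    Continuous fun θ => (volume (S ∩ rotHalf i j α β θ)).toReal := by
  have hm : ∀ θ, MeasurableSet (rotHalf i j α β θ) := fun θ => (isClosed_rotHalf i j α β θ).measurableSet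
  have : IsFiniteMeasure (volume.restrict S) := ⟨by
    rw [Measure.restrict_apply_univ]; exact hS.lt_top⟩
  have e : (fun θ => (volume (S ∩ rotHalf i j α β θ)).toReal) =
      fun θ => ∫ x in S, (rotHalf i j α β θ).indicator (fun _ => (1 : ℝ)) x := by
    funext θ
    rw [integral_indicator (hm θ), setIntegral_const, smul_eq_mul, mul_one, measureReal_def,
      Measure.restrict_apply (hm θ), Set.inter_comm]
  rw [e, continuous_iff_continuousAt]
  intro θ₀
  refine continuousAt_of_dominated (bound := fun _ => 1) ?_ ?_ (integrable_const _) ?_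
  · exact Filter.Eventually.of_forall fun θ =>
      (measurable_const.indicator (hm θ)).aestronglyMeasurable
  · refine Filter.Eventually.of_forall fun θ => Filter.Eventually.of_forall fun x => ?_
    by_cases hx : x ∈ rotHalf i j α β θ <;> simp [hx]
  · have hnull := volume_affine_line_eq_zero hij (Real.cos_sq_add_sin_sq θ₀) α β
    refine ae_restrict_of_ae ?_
    filter_upwards [measure_eq_zero_iff_ae_notMem.1 hnull] with x hx
    have hc : Continuous fun θ => Real.cos θ * (x i - α) + Real.sin θ * (x j - β) := by fun_prop
    rcases lt_or_gt_of_ne hx with h | h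
    · refine (continuousAt_const (y := (1 : ℝ))).congr ?_
      filter_upwards [hc.continuousAt.eventually_lt continuousAt_const h] with θ hθ
      rw [Set.indicator_of_mem (show x ∈ rotHalf i j α β θ from le_of_lt hθ)]
    · refine (continuousAt_const (y := (0 : ℝ))).congr ?_
      filter_upwards [continuousAt_const.eventually_lt hc.continuousAt h] with θ hθ
      rw [Set.indicator_of_notMem (show x ∉ rotHalf i j α β θ from not_le.2 hθ)]

theorem volume_inter_rotHalf_add {n : ℕ} {i j : Fin n} (hij : i ≠ j) (α β θ : ℝ)
    {S : Set (EuclideanSpace ℝ (Fin n))} (hS : volume S ≠ ⊤) :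
    (volume (S ∩ rotHalf i j α β θ)).toReal + (volume (S ∩ rotHalf i j α β (θ + Real.pi))).toReal =
      (volume S).toReal := by
  have hnull := volume_affine_line_eq_zero hij (Real.cos_sq_add_sin_sq θ) α β
  have hm := (isClosed_rotHalf i j α β θ).measurableSet
  have h := measure_inter_add_sdiff (μ := volume) S hm
  have e : (volume (S \ rotHalf i j α β θ)) = volume (S ∩ rotHalf i j α β (θ + Real.pi)) := by
    refine measure_congr ?_
    filter_upwards [measure_eq_zero_iff_ae_notMem.1 hnull] with x hx
    have hx0 : Real.cos θ * (x i - α) + Real.sin θ * (x j - β) ≠ 0 := hx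
    refine propext (and_congr Iff.rfl ?_)
    change ¬ (_ ≤ (0 : ℝ)) ↔ _ ≤ (0 : ℝ)
    rw [Real.cos_add_pi, Real.sin_add_pi, not_le]
    constructor
    · intro h
      linarith
    · intro h
      exact lt_of_le_of_ne (by linarith) (Ne.symm hx0)
  rw [e] at h
  rw [← ENNReal.toReal_add, h]
  · exact ((measure_mono Set.inter_subset_left).trans_lt hS.lt_top).ne
  · exact ((measure_mono Set.inter_subset_left).trans_lt hS.lt_top).ne

/-- Convex bodies in `F` on which `D` has density exactly `e` while `A` has density above `c`. -/
structure IsLocalizing {n : ℕ} (A D F : Set (EuclideanSpace ℝ (Fin n))) (e c : ℝ)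
    (K : Set (EuclideanSpace ℝ (Fin n))) : Prop where
  isCompact : IsCompact K
  convex : Convex ℝ K
  subset : K ⊆ F
  volume_eq : (volume (D ∩ K)).toReal = e * (volume K).toReal
  lt_volume : c * (volume K).toReal < (volume (A ∩ K)).toReal

theorem IsLocalizing.exists_bisection {n : ℕ} {A D F : Set (EuclideanSpace ℝ (Fin n))} {e c : ℝ}
    {K : Set (EuclideanSpace ℝ (Fin n))} (hK : IsLocalizing A D F e c K) {i j : Fin n}
    (hij : i ≠ j) (α β : ℝ) :
    ∃ K' ⊆ K, IsLocalizing A D F e c K' ∧ ∃ a b : ℝ, a ^ 2 + b ^ 2 = 1 ∧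
      ∀ x ∈ K', a * (x i - α) + b * (x j - β) ≤ 0 := by
  have hfin : ∀ S ⊆ K, volume S ≠ ⊤ := fun S hS =>
    ((measure_mono hS).trans_lt hK.isCompact.measure_lt_top).ne
  set H := rotHalf i j α β with hH
  set ψ : ℝ → ℝ := fun θ =>
    (volume (D ∩ K ∩ H θ)).toReal - e * (volume (K ∩ H θ)).toReal with hψ
  have hDK := hfin (D ∩ K) Set.inter_subset_right
  have hψc : Continuous ψ := (continuous_volume_inter_rotHalf hij α β hDK).sub
    ((continuous_volume_inter_rotHalf hij α β (hfin K subset_rfl)).const_mul e)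
  have hψneg : ∀ θ, ψ (θ + Real.pi) = -ψ θ := fun θ => by
    have h1 := volume_inter_rotHalf_add hij α β θ hDK
    have h2 := volume_inter_rotHalf_add hij α β θ (hfin K subset_rfl)
    have h3 := hK.volume_eq
    simp only [hψ, hH]
    rw [← h1, ← h2] at h3
    linarith
  obtain ⟨θ, hθ⟩ : ∃ θ, ψ θ = 0 := by
    have h1 := hψneg 0
    rcases le_total (ψ 0) 0 with h | h
    · exact mem_range_of_exists_le_of_exists_ge hψc ⟨0, h⟩ ⟨0 + Real.pi, by linarith⟩
    · exact mem_range_of_exists_le_of_exists_ge hψc ⟨0 + Real.pi, by linarith⟩ ⟨0, h⟩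
  have hθ' : ψ (θ + Real.pi) = 0 := by rw [hψneg, hθ, neg_zero]
  have mk : ∀ τ, ψ τ = 0 → c * (volume (K ∩ H τ)).toReal < (volume (A ∩ (K ∩ H τ))).toReal →
      ∃ K' ⊆ K, IsLocalizing A D F e c K' ∧ ∃ a b : ℝ, a ^ 2 + b ^ 2 = 1 ∧
        ∀ x ∈ K', a * (x i - α) + b * (x j - β) ≤ 0 := fun τ h1 h2 =>
    ⟨K ∩ H τ, Set.inter_subset_left,
      ⟨hK.isCompact.inter_right (isClosed_rotHalf i j α β τ),
        hK.convex.inter (convex_rotHalf i j α β τ), Set.inter_subset_left.trans hK.subset,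
        by rw [← Set.inter_assoc]; exact sub_eq_zero.1 h1, h2⟩,
      Real.cos τ, Real.sin τ, Real.cos_sq_add_sin_sq τ, fun x hx => hx.2⟩
  by_contra hcon
  have h1 := not_lt.1 fun h => hcon (mk θ hθ h)
  have h2 := not_lt.1 fun h => hcon (mk _ hθ' h)
  have h3 := volume_inter_rotHalf_add hij α β θ (hfin K subset_rfl)
  have h4 := volume_inter_rotHalf_add hij α β θ (hfin (A ∩ K) Set.inter_subset_right)
  have h5 := hK.lt_volume
  rw [Set.inter_assoc, Set.inter_assoc] at h4
  rw [← h3, ← h4, mul_add] at h5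
  linarith

theorem exists_rat_strict_convexCombination {u v : ℝ} (h : u ≠ v) :
    ∃ (q : ℚ) (t : ℝ), 0 < t ∧ t < 1 ∧ (q : ℝ) = (1 - t) * u + t * v := by
  wlog huv : u < v generalizing u v
  · obtain ⟨q, t, h0, h1, hq⟩ := this h.symm (lt_of_le_of_ne (not_lt.1 huv) h.symm)
    exact ⟨q, 1 - t, by linarith, by linarith, by rw [hq]; ring⟩
  obtain ⟨q, h1, h2⟩ := exists_rat_btwn huv
  have h3 : 0 < v - u := sub_pos.2 huv
  refine ⟨q, (q - u) / (v - u), div_pos (by linarith) h3, (div_lt_one h3).2 (by linarith), ?_⟩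
  field_simp
  ring

theorem exists_eq_zero_of_bisected {n : ℕ} {P : Set (EuclideanSpace ℝ (Fin n))} {i j : Fin n}
    (hP : ∀ α β : ℚ, ∃ a b : ℝ, a ^ 2 + b ^ 2 = 1 ∧
      ∀ x ∈ P, a * (x i - α) + b * (x j - β) ≤ 0)
    {x y p : EuclideanSpace ℝ (Fin n)} (hx : x ∈ P) (hy : y ∈ P) (hp : p ∈ P) (hxy : x i = y i)
    (hpx : p i ≠ x i) : x j = y j := by
  by_contra hne
  obtain ⟨α, w, hw0, hw1, hα⟩ := exists_rat_strict_convexCombination hpx.symm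
  have hne' : (1 - w) * x j + w * p j ≠ (1 - w) * y j + w * p j := by
    intro h
    have : (1 - w) * (x j - y j) = 0 := by linarith
    rcases mul_eq_zero.1 this with h | h
    · linarith
    · exact hne (sub_eq_zero.1 h)
  obtain ⟨β, v, hv0, hv1, hβ⟩ := exists_rat_strict_convexCombination hne'
  obtain ⟨a, b, hab, h⟩ := hP α β
  have h1 := h x hx
  have h2 := h y hy
  have h3 := h p hp
  set hx' := a * (x i - α) + b * (x j - β) with ex
  set hy' := a * (y i - α) + b * (y j - β) with ey
  set hp' := a * (p i - α) + b * (p j - β) with ep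
  have hsum : w * hp' + (1 - w) * (1 - v) * hx' + (1 - w) * v * hy' = 0 := by
    rw [ex, ey, ep, hα, hβ, ← hxy]
    ring
  have c1 : w * hp' ≤ 0 := mul_nonpos_of_nonneg_of_nonpos hw0.le h3
  have hw' : 0 < 1 - w := by linarith
  have hv' : 0 < 1 - v := by linarith
  have c2 : (1 - w) * (1 - v) * hx' ≤ 0 := mul_nonpos_of_nonneg_of_nonpos (by positivity) h1
  have c3 : (1 - w) * v * hy' ≤ 0 := mul_nonpos_of_nonneg_of_nonpos (by positivity) h2
  have d1 : hp' = 0 := (mul_eq_zero.1 (show w * hp' = 0 by linarith)).resolve_left hw0.ne'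
  have d2 : hx' = 0 := (mul_eq_zero.1 (show (1 - w) * (1 - v) * hx' = 0 by linarith)).resolve_left
    (by positivity)
  have d3 : hy' = 0 := (mul_eq_zero.1 (show (1 - w) * v * hy' = 0 by linarith)).resolve_left
    (by positivity)
  have hb : b = 0 := by
    have : b * (x j - y j) = 0 := by
      rw [ex] at d2
      rw [ey, ← hxy] at d3
      linarith
    exact (mul_eq_zero.1 this).resolve_right (sub_ne_zero.2 hne)
  have ha : a = 0 := by
    have : a * (p i - x i) = 0 := by
      rw [ex, hb] at d2
      rw [ep, hb] at d1
      linarith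
    exact (mul_eq_zero.1 this).resolve_right (sub_ne_zero.2 hpx)
  rw [ha, hb] at hab
  norm_num at hab

theorem IsLocalizing.exists_thin {n : ℕ} {A D F : Set (EuclideanSpace ℝ (Fin (n + 1)))} {e c ρ : ℝ}
    {K : Set (EuclideanSpace ℝ (Fin (n + 1)))} (hK : IsLocalizing A D F e c K) (hρ : 0 < ρ) :
    ∃ K', IsLocalizing A D F e c K' ∧ ∃ i : Fin (n + 1), ∀ x ∈ K', ∀ y ∈ K', x i = y i →
      dist x y ≤ ρ := by
  obtain ⟨enum, henum⟩ := exists_surjective_nat (Fin (n + 1) × Fin (n + 1) × ℚ × ℚ)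
  have step : ∀ (k : ℕ) (L : {L // IsLocalizing A D F e c L}),
      ∃ L' : {L // IsLocalizing A D F e c L}, L'.1 ⊆ L.1 ∧ ((enum k).1 ≠ (enum k).2.1 →
        ∃ a b : ℝ, a ^ 2 + b ^ 2 = 1 ∧ ∀ x ∈ L'.1,
          a * (x (enum k).1 - (enum k).2.2.1) + b * (x (enum k).2.1 - (enum k).2.2.2) ≤ 0) := by
    intro k L
    by_cases h : (enum k).1 = (enum k).2.1
    · exact ⟨L, subset_rfl, fun h' => absurd h h'⟩
    · obtain ⟨K', h1, h2, h3⟩ := L.2.exists_bisection h (enum k).2.2.1 (enum k).2.2.2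
      exact ⟨⟨K', h2⟩, h1, fun _ => h3⟩
  choose next hsub hcut using step
  set seq : ℕ → {L // IsLocalizing A D F e c L} :=
    fun k => Nat.rec ⟨K, hK⟩ (fun k L => next k L) k with hseq
  have hsucc : ∀ k, seq (k + 1) = next k (seq k) := fun k => rfl
  have hanti : ∀ k, (seq (k + 1)).1 ⊆ (seq k).1 := fun k => hsub k (seq k)
  by_contra! hcon
  have hlim : ∀ i : Fin (n + 1), ∃ x y, (∀ k, x ∈ (seq k).1) ∧ (∀ k, y ∈ (seq k).1) ∧
      x i = y i ∧ x ≠ y := by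
    intro i
    set Z : Set (EuclideanSpace ℝ (Fin (n + 1)) × EuclideanSpace ℝ (Fin (n + 1))) :=
      {z | z.1 i = z.2 i ∧ ρ ≤ dist z.1 z.2} with hZ
    have hZc : IsClosed Z :=
      (isClosed_eq (f := fun z : EuclideanSpace ℝ (Fin (n + 1)) × EuclideanSpace ℝ (Fin (n + 1)) =>
        z.1 i) (g := fun z => z.2 i) (by fun_prop) (by fun_prop)).inter
        (isClosed_le continuous_const continuous_dist)
    have hcpt : ∀ k, IsCompact (((seq k).1 ×ˢ (seq k).1) ∩ Z) := fun k =>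
      ((seq k).2.isCompact.prod (seq k).2.isCompact).inter_right hZc
    obtain ⟨z, hz⟩ := IsCompact.nonempty_iInter_of_sequence_nonempty_isCompact_isClosed
      (fun k => ((seq k).1 ×ˢ (seq k).1) ∩ Z)
      (fun k => Set.inter_subset_inter_left _ (Set.prod_mono (hanti k) (hanti k)))
      (fun k => by
        obtain ⟨x, hx, y, hy, hxy, hd⟩ := hcon (seq k).1 (seq k).2 i
        exact ⟨(x, y), ⟨hx, hy⟩, hxy, hd.le⟩)
      (hcpt 0) (fun k => (hcpt k).isClosed)
    rw [Set.mem_iInter] at hz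
    refine ⟨z.1, z.2, fun k => (hz k).1.1, fun k => (hz k).1.2, (hz 0).2.1, ?_⟩
    exact dist_pos.1 (hρ.trans_le (hz 0).2.2)
  obtain ⟨p, q, hp, hq, -, hpq⟩ := hlim 0
  obtain ⟨i, hi⟩ : ∃ i, p i ≠ q i := by
    by_contra! h
    exact hpq (PiLp.ext h)
  obtain ⟨x, y, hx, hy, hxyi, hxy⟩ := hlim i
  refine hxy (PiLp.ext fun j => ?_)
  by_cases hij : i = j
  · rw [← hij]; exact hxyi
  have hP : ∀ α β : ℚ, ∃ a b : ℝ, a ^ 2 + b ^ 2 = 1 ∧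
      ∀ x ∈ ⋂ k, (seq k).1, a * (x i - α) + b * (x j - β) ≤ 0 := by
    intro α β
    obtain ⟨k, hk⟩ := henum (i, j, α, β)
    have := hcut k (seq k)
    rw [hk] at this
    obtain ⟨a, b, hab, h⟩ := this hij
    exact ⟨a, b, hab, fun x hx => h x (Set.mem_iInter.1 hx (k + 1))⟩
  by_cases hpx : p i = x i
  · exact exists_eq_zero_of_bisected hP (Set.mem_iInter.2 hx) (Set.mem_iInter.2 hy)
      (Set.mem_iInter.2 hq) hxyi (fun h => hi (hpx.trans h.symm))
  · exact exists_eq_zero_of_bisected hP (Set.mem_iInter.2 hx) (Set.mem_iInter.2 hy)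
      (Set.mem_iInter.2 hp) hxyi hpx

theorem IsLocalizing.false_of_cthickening {n : ℕ} {E F : Set (EuclideanSpace ℝ (Fin (n + 1)))}
    (hE : IsClosed E) {lam e ρ : ℝ} (hlam : 1 < lam) (he : 0 ≤ e) (hρ : 0 < ρ)
    {K : Set (EuclideanSpace ℝ (Fin (n + 1)))}
    (h : IsLocalizing (core E F lam) (Metric.cthickening ρ E) F e (e ^ lam) K) : False := by
  obtain ⟨L, hL, i, hthin⟩ := h.exists_thin hρ
  have key := rpow_volume_core_inter_le_of_fibres hE hL.isCompact hL.convex hL.subset hlam i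
    (D := Metric.cthickening ρ E)
    fun x hx y hy hyE hxy => Metric.mem_cthickening_of_dist_le x y ρ E hyE (hthin x hx y hy hxy)
  have hlt := hL.lt_volume
  rw [hL.volume_eq] at key
  have hle : (volume (core E F lam ∩ L)).toReal ≤ (volume L).toReal :=
    ENNReal.toReal_mono hL.isCompact.measure_lt_top.ne (measure_mono Set.inter_subset_right)
  have hV0 : 0 ≤ (volume L).toReal := ENNReal.toReal_nonneg
  have hc0 : 0 ≤ e ^ lam := Real.rpow_nonneg he _
  have hlam0 : 0 < lam := by linarith
  rcases hV0.eq_or_lt with hV | hV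
  · rw [← hV] at hle hlt
    linarith
  have h1 : (e ^ lam * (volume L).toReal) ^ lam⁻¹ <
      (volume (core E F lam ∩ L)).toReal ^ lam⁻¹ :=
    Real.rpow_lt_rpow (by positivity) hlt (inv_pos.2 hlam0)
  rw [Real.mul_rpow hc0 hV0, ← Real.rpow_mul he, mul_inv_cancel₀ hlam0.ne', Real.rpow_one] at h1
  have h2 := mul_lt_mul_of_pos_right h1 (Real.rpow_pos_of_pos hV (1 - lam⁻¹))
  rw [mul_assoc, ← Real.rpow_add hV, add_sub_cancel, Real.rpow_one] at h2
  linarith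

theorem volume_core_le_of_cthickening {n : ℕ} {E F : Set (EuclideanSpace ℝ (Fin (n + 1)))}
    (hE : IsClosed E) (hEF : E ⊆ F) (hF : IsCompact F) (hFc : Convex ℝ F)
    (hF0 : 0 < (volume F).toReal) {lam ρ : ℝ} (hlam : 1 < lam) (hρ : 0 < ρ) :
    (volume (core E F lam)).toReal / (volume F).toReal ≤
      ((volume (Metric.cthickening ρ E)).toReal / (volume F).toReal) ^ lam := by
  set e := (volume (Metric.cthickening ρ E ∩ F)).toReal / (volume F).toReal with he
  have he0 : 0 ≤ e := by positivity
  have hcF : core E F lam ∩ F = core E F lam :=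
    Set.inter_eq_left.2 fun x hx => hEF hx.1
  have h1 : (volume (core E F lam)).toReal ≤ e ^ lam * (volume F).toReal := by
    by_contra hcon
    refine IsLocalizing.false_of_cthickening (F := F) hE hlam he0 hρ (K := F)
      ⟨hF, hFc, subset_rfl, ?_, ?_⟩
    · rw [he]
      field_simp
    · rw [hcF]
      exact not_le.1 hcon
  have hfin : volume (Metric.cthickening ρ E) ≠ ⊤ :=
    (hF.of_isClosed_subset hE hEF).cthickening.measure_lt_top.ne
  have h2 : e ≤ (volume (Metric.cthickening ρ E)).toReal / (volume F).toReal := by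
    rw [he]
    gcongr
    exact Set.inter_subset_left
  rw [div_le_iff₀ hF0]
  refine h1.trans ?_
  gcongr

theorem geometric_KLS {n : ℕ} (F E : Set (EuclideanSpace ℝ (Fin n)))
    (hFcomp : IsCompact F) (hFconv : Convex ℝ F) (hFint : (interior F).Nonempty)
    (hEclosed : IsClosed E) (hEF : E ⊆ F) (lam : ℝ) (hlam : 1 < lam) :
    (volume (core E F lam)).toReal / (volume F).toReal ≤
      ((volume E).toReal / (volume F).toReal) ^ lam := by
  have hF0 : 0 < (volume F).toReal := ENNReal.toReal_pos
    (((isOpen_interior.measure_pos volume hFint).trans_le (measure_mono interior_subset)).ne')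
    hFcomp.measure_lt_top.ne
  have hlam0 : 0 < lam := by linarith
  cases n with
  | zero =>
    rcases E.eq_empty_or_nonempty with hE | hE
    · have hcore : core E F lam = ∅ := by
        rw [Set.eq_empty_iff_forall_notMem]
        intro x hx
        simpa [hE] using hx.1
      rw [hcore, hE]
      simp [Real.zero_rpow hlam0.ne']
    · have hEu : E = Set.univ := Subsingleton.eq_univ_of_nonempty hE
      have hFu : F = Set.univ := Set.univ_subset_iff.1 (hEu ▸ hEF)
      rw [hFu] at hF0
      rw [hEu, hFu, div_self hF0.ne', Real.one_rpow]
      refine (div_le_one hF0).2 (ENNReal.toReal_mono ?_ (measure_mono (Set.subset_univ _)))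
      rw [← hFu]
      exact hFcomp.measure_lt_top.ne
  | succ m =>
    have hEc : IsCompact E := hFcomp.of_isClosed_subset hEclosed hEF
    have hlim := tendsto_measure_cthickening_of_isClosed (μ := volume)
      ⟨1, one_pos, hEc.cthickening.measure_lt_top.ne⟩ hEclosed
    have hlim' := (ENNReal.tendsto_toReal hEc.measure_lt_top.ne).comp hlim
    have hlim'' : Filter.Tendsto
        (fun ρ => ((volume (Metric.cthickening ρ E)).toReal / (volume F).toReal) ^ lam)
        (nhdsWithin 0 (Set.Ioi 0)) (nhds (((volume E).toReal / (volume F).toReal) ^ lam)) :=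
      ((hlim'.div_const _).rpow_const (Or.inr hlam0.le)).mono_left nhdsWithin_le_nhds
    refine ge_of_tendsto hlim'' ?_
    filter_upwards [self_mem_nhdsWithin] with ρ hρ
    exact volume_core_le_of_cthickening hEclosed hEF hFcomp hFconv hF0 hlam hρ
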